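/- Assume all the measures dv_g and ν_a are simple, set ψ_r = u_{a_{r,e₁}}^{s(a_{r,e₁})} and φ = X_{e₁}. Then the map r ∈ (−1,1) ↦ ψ_r ∈ L²(S^n, dv_g) is continuous, ψ_r → −φ in L² as r → −1, and ψ_r → φ in L² as r → 1. -/

import Mathlib

open MeasureTheory Metric Real Filter Set
open scoped RealInnerProductSpace ENNReal NNReal Topology Classical

noncomputable section

/-- Ambient Euclidean space `ℝ^{n+1}`. -/
abbrev Eu (n : ℕ) : Type := EuclideanSpace ℝ (Fin (n + 1))

/-- The unit sphere `S^n ⊆ ℝ^{n+1}` as a subset of the ambient space. -/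
def sphSet (n : ℕ) : Set (Eu n) := Metric.sphere (0 : Eu n) 1

/-- The canonical (round) volume measure of `S^n`, viewed as a measure on the
ambient space `ℝ^{n+1}` supported on the unit sphere. -/
def sphMeasure (n : ℕ) : Measure (Eu n) :=
  Measure.map Subtype.val ((volume : Measure (Eu n)).toSphere)

/-- `σ_n`, the volume of the round unit `n`-sphere. -/
def sigmaVol (n : ℕ) : ℝ := (sphMeasure n Set.univ).toReal

/-- The constant `K_n`. -/
def Kconst (n : ℕ) : ℝ :=
  ((n + 1 : ℝ) / n) *
    ((Real.Gamma n * Real.Gamma ((n + 1) / 2)) /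
      (Real.Gamma (n + 1 / 2) * Real.Gamma (n / 2))) ^ ((2 : ℝ) / n)

/-- The linear coordinate function `X_s(x) = s · x`. -/
def Xfun {n : ℕ} (s x : Eu n) : ℝ := ⟪s, x⟫

/-- The tangential gradient on the sphere of (the restriction of) an ambient function:
`∇_{S^n} f (x) = ∇f(x) - ⟨∇f(x), x⟩ x`. -/
def gradS {n : ℕ} (f : Eu n → ℝ) (x : Eu n) : Eu n :=
  gradient f x - ⟪gradient f x, x⟫ • x

/-- A conformal factor `w` represents the metric `g = w² g₀` on `S^n`; it is admissible if it
is smooth and positive on the sphere. -/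
def IsConformalFactor (n : ℕ) (w : Eu n → ℝ) : Prop :=
  ContDiff ℝ (⊤ : ℕ∞) w ∧ ∀ x ∈ sphSet n, 0 < w x

/-- The Riemannian measure `dv_g` of the conformal metric `g = w² g₀`, i.e. `w^n dv_{g₀}`. -/
def confMeasure (n : ℕ) (w : Eu n → ℝ) : Measure (Eu n) :=
  (sphMeasure n).withDensity fun x => ENNReal.ofReal (w x ^ n)

/-- The volume of `(S^n, g)`, `g = w² g₀`. -/
def confVol (n : ℕ) (w : Eu n → ℝ) : ℝ := (confMeasure n w Set.univ).toReal

/-- The Dirichlet energy `∫ |∇_g u|²_g dv_g` of the restriction to `S^n` of `V`,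
for `g = w² g₀`: it equals `∫ w^{n-2} |∇_{g₀} V|²_{g₀} dv_{g₀}`. -/
def dirichlet (n : ℕ) (w : Eu n → ℝ) (V : Eu n → ℝ) : ℝ :=
  ∫ x, w x ^ (n - 2) * ‖gradS V x‖ ^ 2 ∂(sphMeasure n)

/-- `∫ u² dv_g`. -/
def l2sq (n : ℕ) (w : Eu n → ℝ) (V : Eu n → ℝ) : ℝ :=
  ∫ x, (V x) ^ 2 ∂(confMeasure n w)

/-- Mean value zero w.r.t. `dv_g`. -/
def MeanZero (n : ℕ) (w : Eu n → ℝ) (V : Eu n → ℝ) : Prop :=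
  ∫ x, V x ∂(confMeasure n w) = 0

/-- The second nonzero eigenvalue `λ₂(S^n, g)` of the Laplace–Beltrami operator of
`g = w² g₀`, defined via the Courant–Fischer min-max characterization over two-dimensional
spaces of mean-zero test functions (restrictions of smooth ambient functions). -/
def lambda2 (n : ℕ) (w : Eu n → ℝ) : ℝ :=
  sInf { Λ : ℝ | ∃ V W : Eu n → ℝ, ContDiff ℝ (⊤ : ℕ∞) V ∧ ContDiff ℝ (⊤ : ℕ∞) W ∧
    MeanZero n w V ∧ MeanZero n w W ∧
    (∀ a b : ℝ, (∀ x ∈ sphSet n, a * V x + b * W x = 0) → a = 0 ∧ b = 0) ∧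
    Λ = sSup { q : ℝ | ∃ a b : ℝ, ¬(a = 0 ∧ b = 0) ∧
      q = dirichlet n w (fun x => a * V x + b * W x) /
          l2sq n w (fun x => a * V x + b * W x) } }

/-- The conformal transformation `d_ξ` of the closed unit ball. -/
def dMap {n : ℕ} (ξ : Eu n) (x : Eu n) : Eu n :=
  (1 + 2 * ⟪ξ, x⟫ + ‖x‖ ^ 2 * ‖ξ‖ ^ 2)⁻¹ •
    ((1 - ‖ξ‖ ^ 2) • x + (1 + 2 * ⟪ξ, x⟫ + ‖x‖ ^ 2) • ξ)

/-- The reflection `R_p(x) = x - 2(p·x)p`. -/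
def Refl {n : ℕ} (p x : Eu n) : Eu n := x - (2 * ⟪p, x⟫) • p

/-- The spherical cap `a_{r,p} = d_{rp}(a_{0,p})`. -/
def cap (n : ℕ) (r : ℝ) (p : Eu n) : Set (Eu n) :=
  dMap (r • p) '' {x ∈ sphSet n | 0 < ⟪p, x⟫}

/-- The conformal reflection `τ_{a_{r,p}} = d_{rp} ∘ R_p ∘ d_{-rp}`. -/
def tauMap {n : ℕ} (r : ℝ) (p : Eu n) : Eu n → Eu n :=
  dMap (r • p) ∘ Refl p ∘ dMap (-(r • p))

/-- The measure `μ_{a_{r,p}}`, equal to `dv_g + (τ_a)^* dv_g` on `a` and `0` on `a^*`. -/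
def capMeasure (n : ℕ) (w : Eu n → ℝ) (r : ℝ) (p : Eu n) : Measure (Eu n) :=
  (confMeasure n w + Measure.map (tauMap r p) (confMeasure n w)).restrict (cap n r p)

/-- `d_ξ` renormalizes the finite measure `μ`: `∫ X_s ∘ d_ξ dμ = 0` for all `s ∈ S^n`. -/
def Renormalizes {n : ℕ} (ξ : Eu n) (μ : Measure (Eu n)) : Prop :=
  ∀ s ∈ sphSet n, ∫ x, Xfun s (dMap ξ x) ∂μ = 0

/-- The quadratic form `Q(s) = ∫ X_s² dν` of a measure `ν`. -/
def Qform {n : ℕ} (ν : Measure (Eu n)) (s : Eu n) : ℝ := ∫ x, (⟪s, x⟫ : ℝ) ^ 2 ∂ν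

/-- The maximal eigenvalue of the quadratic form `Q`. -/
def maxEig (n : ℕ) (ν : Measure (Eu n)) : ℝ :=
  sSup { q : ℝ | ∃ s : Eu n, ‖s‖ = 1 ∧ q = Qform ν s }

/-- `ν` is simple with (unit) maximal direction `s₀`: the eigenspace of the maximal
eigenvalue of `Q` is the line spanned by `s₀`. -/
def IsMaxDir {n : ℕ} (ν : Measure (Eu n)) (s₀ : Eu n) : Prop :=
  ‖s₀‖ = 1 ∧ ∀ s : Eu n, Qform ν s = maxEig n ν * ‖s‖ ^ 2 ↔ ∃ c : ℝ, s = c • s₀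

/-- `ν` is multiple: the eigenspace of the maximal eigenvalue of `Q` has dimension ≥ 2. -/
def IsMultiple {n : ℕ} (ν : Measure (Eu n)) : Prop :=
  ∃ s t : Eu n, Qform ν s = maxEig n ν * ‖s‖ ^ 2 ∧ Qform ν t = maxEig n ν * ‖t‖ ^ 2 ∧
    LinearIndependent ℝ ![s, t]

/-- The test function `u_a^s` (for `a = a_{r,p}` with renormalization point `ξ`):
`X_s ∘ d_ξ` on `a` and `X_s ∘ d_ξ ∘ τ_a` on `a^*`. -/
def testFun (n : ℕ) (ξ : Eu n) (r : ℝ) (p : Eu n) (s : Eu n) (x : Eu n) : ℝ :=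
  if 0 < ⟪p, dMap (-(r • p)) x⟫ then Xfun s (dMap ξ x) else Xfun s (dMap ξ (tauMap r p x))

/-- The first coordinate vector `e₁ ∈ ℝ^{n+1}`. -/
def e1 (n : ℕ) : Eu n := EuclideanSpace.single 0 1

/-- The top coefficient of `s ↦ det (1 + s A)` is `det A`, by Lagrange interpolation. -/
theorem det_eq_sum_interpolation {E : Type*} [NormedAddCommGroup E] [NormedSpace ℝ E]
    [FiniteDimensional ℝ E] {s : Finset ℝ} (hs : s.card = Module.finrank ℝ E + 1)
    (A : E →L[ℝ] E) :
    A.det = ∑ t ∈ s, (1 + t • A).det / ∏ u ∈ s.erase t, (t - u) := by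
  let b := Module.finBasis ℝ E
  have key : ∀ B : E →L[ℝ] E,
      B.det = (LinearMap.toMatrix b b (B : E →ₗ[ℝ] E)).det := fun B => by
    rw [LinearMap.det_toMatrix]
  set M := LinearMap.toMatrix b b (A : E →ₗ[ℝ] E) with hM
  set P : Polynomial ℝ := Matrix.det ((Polynomial.X : Polynomial ℝ) •
    M.map Polynomial.C + (1 : Matrix _ _ ℝ).map Polynomial.C) with hP
  have hdeg : P.degree < s.card := by
    refine lt_of_le_of_lt Polynomial.degree_le_natDegree ?_
    have := Polynomial.natDegree_det_X_add_C_le M 1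
    rw [Fintype.card_fin] at this
    rw [hs]
    exact_mod_cast Nat.lt_succ_of_le this
  have h1 := Lagrange.coeff_eq_sum (s := s) (v := id) (Function.injective_id.injOn) hdeg
  have h2 := Polynomial.coeff_det_X_add_C_card M 1
  rw [Fintype.card_fin] at h2
  rw [hs, Nat.add_sub_cancel, h2] at h1
  rw [key A, ← hM, h1]
  refine Finset.sum_congr rfl fun t _ => ?_
  congr 1
  rw [key, hP, ← Polynomial.coe_evalRingHom, RingHom.map_det]
  congr 1
  ext i j
  simp [M, Matrix.one_apply, LinearMap.toMatrix_apply, Matrix.map_apply, apply_ite,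
    Finsupp.single_apply, eq_comm]
  split_ifs <;> ring

theorem sum_inv_prod_sub_eq_zero {s : Finset ℝ} (hs : 1 < s.card) :
    ∑ t ∈ s, 1 / ∏ u ∈ s.erase t, (t - u) = (0 : ℝ) := by
  have h1 := Lagrange.coeff_eq_sum (s := s) (v := id) (P := (1 : Polynomial ℝ))
    (Function.injective_id.injOn)
    (by rw [Polynomial.degree_one]; exact_mod_cast (by omega : 0 < s.card))
  rw [Polynomial.coeff_one, if_neg (by omega)] at h1
  simpa using h1.symm

/-- A `C¹` compactly supported perturbation of the identity preserves the volume of a large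
ball, if the perturbation is small. -/
theorem setIntegral_det_one_add_smul_fderiv {E : Type*} [NormedAddCommGroup E]
    [NormedSpace ℝ E] [FiniteDimensional ℝ E] [MeasurableSpace E] [BorelSpace E]
    (μ : Measure E) [μ.IsAddHaarMeasure] {K : E → E} {R : ℝ} (hK : ContDiff ℝ 1 K)
    (hR : ∀ x, x ∉ ball (0 : E) R → K x = 0) :
    ∃ δ : ℝ, 0 < δ ∧ ∀ t ∈ Ioo 0 δ,
      ∫ x in ball (0 : E) R, (1 + t • fderiv ℝ K x).det ∂μ = μ.real (ball 0 R) := by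
  have hcs : HasCompactSupport K :=
    HasCompactSupport.intro (isCompact_closedBall (0 : E) R) fun x hx =>
      hR x fun h => hx (ball_subset_closedBall h)
  obtain ⟨C, hC⟩ := hK.lipschitzWith_of_hasCompactSupport hcs one_ne_zero
  have hfd : ∀ x, ‖fderiv ℝ K x‖ ≤ C := fun x => norm_fderiv_le_of_lipschitz ℝ hC
  refine ⟨1 / (C + 1), by positivity, fun t ht => ?_⟩
  have htC : t * C < 1 := by
    have h1 : t * (C + 1) < 1 := by
      have := ht.2
      rwa [lt_div_iff₀ (by positivity)] at this
    nlinarith [ht.1]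
  set f : E → E := fun x => x + t • K x with hf
  have hder : ∀ x, HasFDerivAt f (1 + t • fderiv ℝ K x) x := fun x =>
    (hasFDerivAt_id x).add
      (((hK.differentiable one_ne_zero x).hasFDerivAt).const_smul t)
  -- injectivity
  have hinj : Function.Injective f := by
    intro x y hxy
    by_contra hne
    have h1 : x - y = t • (K y - K x) := by
      have : x + t • K x = y + t • K y := hxy
      rw [smul_sub, sub_eq_sub_iff_add_eq_add, this, add_comm]
    have h2 : ‖x - y‖ ≤ t * (C * ‖x - y‖) := by
      calc ‖x - y‖ = t * ‖K y - K x‖ := by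
            rw [h1, norm_smul, Real.norm_of_nonneg ht.1.le]
        _ ≤ t * (C * ‖x - y‖) := by
            gcongr
            · exact ht.1.le
            · rw [norm_sub_rev x y]; exact hC.norm_sub_le y x
    have h3 : 0 < ‖x - y‖ := norm_pos_iff.2 (sub_ne_zero.2 hne)
    nlinarith
  have happ : ApproximatesLinearOn f (ContinuousLinearEquiv.refl ℝ E : E →L[ℝ] E) univ
      (t.toNNReal * C) := by
    intro x _ y _
    have : f x - f y - (x - y) = t • (K x - K y) := by
      simp only [hf, smul_sub]; abel
    simp only [ContinuousLinearEquiv.coe_refl, ContinuousLinearMap.coe_id', id_eq]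
    rw [this, norm_smul, Real.norm_of_nonneg ht.1.le, NNReal.coe_mul, mul_assoc,
      Real.coe_toNNReal t ht.1.le]
    exact mul_le_mul_of_nonneg_left (hC.norm_sub_le x y) ht.1.le
  have hsurj : Function.Surjective f := by
    rcases subsingleton_or_nontrivial E with hE | hE
    · exact fun y => ⟨y, Subsingleton.elim _ _⟩
    refine happ.surjective (Or.inr ?_)
    rw [← NNReal.coe_lt_coe]
    have : ‖((ContinuousLinearEquiv.refl ℝ E).symm : E →L[ℝ] E)‖₊ = 1 := by
      rw [ContinuousLinearEquiv.refl_symm, ContinuousLinearEquiv.coe_refl]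
      exact NNReal.eq (ContinuousLinearMap.norm_id)
    rw [this, NNReal.coe_mul, Real.coe_toNNReal t ht.1.le]; simpa using htC
  have himg : f '' ball 0 R = ball 0 R := by
    have hout : ∀ x, x ∉ ball (0 : E) R → f x = x := fun x hx => by simp [hf, hR x hx]
    ext y
    constructor
    · rintro ⟨x, hx, rfl⟩
      by_contra hy
      have := hinj ((hout _ hy).trans rfl)
      rw [this] at hy
      exact hy hx
    · intro hy
      obtain ⟨x, rfl⟩ := hsurj y
      refine ⟨x, ?_, rfl⟩
      by_contra hx
      rw [hout x hx] at hy
      exact hx hy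
  have hdet : ∀ x, 0 < (1 + t • fderiv ℝ K x).det := by
    intro x
    have hne : ∀ u ∈ Icc (0 : ℝ) t, (1 + u • fderiv ℝ K x).det ≠ 0 := by
      intro u hu h0
      have hker : ∃ v : E, v ≠ 0 ∧ (1 + u • fderiv ℝ K x) v = 0 := by
        have := LinearMap.bot_lt_ker_of_det_eq_zero
          (f := ((1 + u • fderiv ℝ K x : E →L[ℝ] E) : E →ₗ[ℝ] E)) h0
        obtain ⟨v, hv, hv0⟩ := (Submodule.ne_bot_iff _).1 this.ne'
        exact ⟨v, hv0, hv⟩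
      obtain ⟨v, hv, h⟩ := hker
      have h1 : v = -(u • fderiv ℝ K x v) := by
        have : v + u • fderiv ℝ K x v = 0 := h
        exact eq_neg_of_add_eq_zero_left this
      have h2 : ‖v‖ ≤ u * (C * ‖v‖) := by
        calc ‖v‖ = u * ‖fderiv ℝ K x v‖ := by
              conv_lhs => rw [h1]
              rw [norm_neg, norm_smul, Real.norm_of_nonneg hu.1]
          _ ≤ u * (C * ‖v‖) := by
              gcongr
              · exact hu.1
              · exact (fderiv ℝ K x).le_of_opNorm_le (hfd x) v
      have h3 : 0 < ‖v‖ := norm_pos_iff.2 hv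
      have h4 : u * C ≤ t * C := mul_le_mul_of_nonneg_right hu.2 C.2
      nlinarith
    by_contra hneg
    have hcont : ContinuousOn (fun u : ℝ => (1 + u • fderiv ℝ K x).det) (Icc 0 t) :=
      (ContinuousLinearMap.continuous_det.comp (by fun_prop)).continuousOn
    have h0 : (0 : ℝ) ∈ Icc ((1 + t • fderiv ℝ K x).det)
        ((1 + (0 : ℝ) • fderiv ℝ K x).det) := by
      refine ⟨not_lt.1 hneg, ?_⟩
      rw [zero_smul, add_zero]
      show (0 : ℝ) ≤ LinearMap.det (LinearMap.id : E →ₗ[ℝ] E)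
      simp
    obtain ⟨u, hu, hu0⟩ := intermediate_value_Icc' ht.1.le hcont h0
    exact hne u hu hu0
  have hcv := integral_image_eq_integral_abs_det_fderiv_smul μ
    (measurableSet_ball (x := (0 : E)) (ε := R))
    (fun x _ => (hder x).hasFDerivWithinAt) hinj.injOn (fun _ => (1 : ℝ))
  rw [himg] at hcv
  simp only [smul_eq_mul, mul_one, integral_const, MeasurableSet.univ, measureReal_restrict_apply,
    univ_inter, abs_of_pos (hdet _)] at hcv
  exact hcv.symm

/-- The Jacobian determinant of a compactly supported `C¹` self-map has integral zero. -/
theorem integral_det_fderiv_eq_zero {E : Type*} [NormedAddCommGroup E]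
    [NormedSpace ℝ E] [FiniteDimensional ℝ E] [Nontrivial E] [MeasurableSpace E] [BorelSpace E]
    (μ : Measure E) [μ.IsAddHaarMeasure] {K : E → E} (hK : ContDiff ℝ 1 K)
    (hc : HasCompactSupport K) : ∫ x, (fderiv ℝ K x).det ∂μ = 0 := by
  obtain ⟨R, hR⟩ := hc.isCompact.isBounded.subset_ball (0 : E)
  have hK0 : ∀ x, x ∉ ball (0 : E) R → K x = 0 := fun x hx =>
    image_eq_zero_of_notMem_tsupport fun h => hx (hR h)
  obtain ⟨δ, hδ, hvol⟩ := setIntegral_det_one_add_smul_fderiv μ hK hK0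
  obtain ⟨s, hsub, hcard⟩ :=
    (Ioo_infinite hδ).exists_subset_card_eq (Module.finrank ℝ E + 1)
  have hpos : 0 < Module.finrank ℝ E := Module.finrank_pos
  have hdet0 : (0 : E →L[ℝ] E).det = 0 := by
    show LinearMap.det (0 : E →ₗ[ℝ] E) = 0
    rw [LinearMap.det_zero, zero_pow hpos.ne']
  have h1 : ∫ x, (fderiv ℝ K x).det ∂μ = ∫ x in ball (0 : E) R, (fderiv ℝ K x).det ∂μ := by
    symm
    refine setIntegral_eq_integral_of_forall_compl_eq_zero fun x hx => ?_
    rw [show fderiv ℝ K x = 0 from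
      image_eq_zero_of_notMem_tsupport fun h => hx (hR (tsupport_fderiv_subset ℝ h)), hdet0]
  rw [h1]
  have h2 : ∀ x, (fderiv ℝ K x).det =
      ∑ t ∈ s, (1 + t • fderiv ℝ K x).det / ∏ u ∈ s.erase t, (t - u) := fun x =>
    det_eq_sum_interpolation hcard _
  have hcf := hK.continuous_fderiv one_ne_zero
  have hint : ∀ t ∈ s, Integrable
      (fun x => (1 + t • fderiv ℝ K x).det / ∏ u ∈ s.erase t, (t - u))
      (μ.restrict (ball 0 R)) := fun t _ => by
    have : Continuous fun x => (1 + t • fderiv ℝ K x).det / ∏ u ∈ s.erase t, (t - u) :=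
      (ContinuousLinearMap.continuous_det.comp (by fun_prop)).div_const _
    exact (this.continuousOn.integrableOn_compact (isCompact_closedBall (0 : E) R)).mono_set
      ball_subset_closedBall
  simp_rw [h2]
  rw [integral_finsetSum _ hint]
  simp_rw [integral_div]
  rw [Finset.sum_congr rfl fun t ht => by rw [hvol t (hsub ht), div_eq_mul_one_div],
    ← Finset.mul_sum, sum_inv_prod_sub_eq_zero (by omega), mul_zero]

/-- The coordinatewise map `y ↦ (σ (y i))ᵢ` on Euclidean space. -/
def coordMap {n : ℕ} (σ : ℝ → ℝ) (y : Eu n) : Eu n :=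
  WithLp.toLp 2 fun i => σ (y i)

theorem contDiff_coordMap {n : ℕ} {σ : ℝ → ℝ} (hσ : ContDiff ℝ 1 σ) :
    ContDiff ℝ 1 (coordMap (n := n) σ) := by
  rw [contDiff_euclidean]
  intro i
  exact hσ.comp ((contDiff_euclidean.1 contDiff_id) i)

theorem det_fderiv_coordMap {n : ℕ} {σ β : ℝ → ℝ} (hσ : ∀ t, HasDerivAt σ (β t) t)
    (y : Eu n) : (fderiv ℝ (coordMap σ) y).det = ∏ i, β (y i) := by
  have h1 : ∀ i, HasFDerivAt (fun z : Eu n => coordMap σ z i)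
      (β (y i) • (EuclideanSpace.proj i : Eu n →L[ℝ] ℝ)) y := fun i =>
    (hσ (y i)).comp_hasFDerivAt y (EuclideanSpace.proj (𝕜 := ℝ) i).hasFDerivAt
  have hd : DifferentiableAt ℝ (coordMap σ) y :=
    (differentiableAt_euclidean).2 fun i => (h1 i).differentiableAt
  have h2 := fun i => (EuclideanSpace.proj (𝕜 := ℝ) i).hasFDerivAt.comp y hd.hasFDerivAt
  have h3 : ∀ v i, (fderiv ℝ (coordMap σ) y v) i = β (y i) * v i := fun v i => by
    have := DFunLike.congr_fun ((h2 i).unique (h1 i)) v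
    simpa using this
  rw [ContinuousLinearMap.det,
    ← LinearMap.det_toMatrix (EuclideanSpace.basisFun (Fin (n + 1)) ℝ).toBasis]
  have : LinearMap.toMatrix (EuclideanSpace.basisFun (Fin (n + 1)) ℝ).toBasis
      (EuclideanSpace.basisFun (Fin (n + 1)) ℝ).toBasis
      (fderiv ℝ (coordMap σ) y : Eu n →ₗ[ℝ] Eu n) =
      Matrix.diagonal fun i => β (y i) := by
    ext i j
    rw [LinearMap.toMatrix_apply]
    simp [h3, Matrix.diagonal_apply]
  rw [this, Matrix.det_diagonal]

theorem integral_prod_coord {n : ℕ} (β : ℝ → ℝ) :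
    ∫ y : Eu n, ∏ i, β (y i) = (∫ t, β t) ^ (n + 1) := by
  have := (PiLp.volume_preserving_toLp (Fin (n + 1))).integral_comp
    (MeasurableEquiv.toLp 2 (Fin (n + 1) → ℝ)).measurableEmbedding
    (fun y : Eu n => ∏ i, β (y i))
  rw [← this]
  simpa using integral_fintype_prod_volume_eq_pow (ι := Fin (n + 1)) β

/-- The degree formula: a `C¹` map that is the identity near infinity has degree one. -/
theorem integral_prod_comp_mul_det_fderiv {n : ℕ} {β : ℝ → ℝ} (hβ : Continuous β)
    (hβ1 : ∫ t, β t = 1) {G : Eu n → Eu n}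
    (hG : ContDiff ℝ 1 G) {R : ℝ} (hGR : ∀ x, R ≤ ‖x‖ → G x = x)
    (hβc : HasCompactSupport fun y : Eu n => ∏ i, β (y i)) :
    ∫ x, (∏ i, β (G x i)) * (fderiv ℝ G x).det = 1 := by
  set σ : ℝ → ℝ := fun t => ∫ u in (0 : ℝ)..t, β u with hσ
  have hσd : ∀ t, HasDerivAt σ (β t) t := fun t =>
    intervalIntegral.integral_hasDerivAt_right (hβ.intervalIntegrable _ _)
      (hβ.stronglyMeasurableAtFilter _ _) hβ.continuousAt
  have hσ1 : ContDiff ℝ 1 σ := by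
    rw [contDiff_one_iff_deriv]
    refine ⟨fun t => (hσd t).differentiableAt, ?_⟩
    rwa [show deriv σ = β from funext fun t => (hσd t).deriv]
  have hS := contDiff_coordMap (n := n) hσ1
  set S : Eu n → Eu n := coordMap σ with hSdef
  set φ : Eu n → ℝ := fun y => ∏ i, β (y i) with hφ
  have hφc : Continuous φ := by
    refine continuous_finsetProd _ fun i _ => hβ.comp ?_
    fun_prop
  let l : ContDiffBump (0 : Eu n) := ⟨max R 0 + 1, max R 0 + 2, by positivity, by linarith⟩
  have hl : ContDiff ℝ 1 l := l.contDiff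
  have hSG : ContDiff ℝ 1 (S ∘ G) := hS.comp hG
  have h1 := integral_det_fderiv_eq_zero (volume : Measure (Eu n)) (K := fun x => l x • S (G x))
    (hl.smul hSG) (l.hasCompactSupport.smul_right)
  have h2 := integral_det_fderiv_eq_zero (volume : Measure (Eu n)) (K := fun x => l x • S x)
    (hl.smul hS) (l.hasCompactSupport.smul_right)
  have hdet : ∀ x, (fderiv ℝ (S ∘ G) x).det = φ (G x) * (fderiv ℝ G x).det := fun x => by
    rw [fderiv_comp x (hS.differentiable one_ne_zero _) (hG.differentiable one_ne_zero _)]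
    rw [show φ (G x) = _ from (det_fderiv_coordMap hσd (G x)).symm]
    exact LinearMap.det_comp _ _
  have hin : ∀ x, ‖x‖ < max R 0 + 1 → ∀ H : Eu n → Eu n,
      fderiv ℝ (fun x => l x • H x) x = fderiv ℝ H x := fun x hx H => by
    refine Filter.EventuallyEq.fderiv_eq ?_
    filter_upwards [(isOpen_lt continuous_norm continuous_const).mem_nhds hx] with y hy
    rw [l.one_of_mem_closedBall (by simpa using le_of_lt hy), one_smul]
  have hout : ∀ x, max R 0 < ‖x‖ → fderiv ℝ (fun x => l x • S (G x)) x =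
      fderiv ℝ (fun x => l x • S x) x ∧ fderiv ℝ G x = ContinuousLinearMap.id ℝ (Eu n) ∧
        G x = x := by
    intro x hx
    have hev : G =ᶠ[𝓝 x] id := by
      filter_upwards [(isOpen_lt continuous_const continuous_norm).mem_nhds hx] with y hy
      exact hGR y ((le_max_left _ _).trans hy.le)
    refine ⟨Filter.EventuallyEq.fderiv_eq ?_, ?_, hev.eq_of_nhds⟩
    · filter_upwards [hev] with y hy
      rw [hy, id]
    · rw [hev.fderiv_eq, fderiv_id]
  have key : ∀ x, (fderiv ℝ (fun x => l x • S (G x)) x).det -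
      (fderiv ℝ (fun x => l x • S x) x).det = φ (G x) * (fderiv ℝ G x).det - φ x := by
    intro x
    rcases lt_or_ge (max R 0) ‖x‖ with hx | hx
    · obtain ⟨a, b, c⟩ := hout x hx
      rw [a, b, c]
      simp [ContinuousLinearMap.det]
    · rw [hin x (by linarith) (fun x => S (G x)), hin x (by linarith) S]
      rw [det_fderiv_coordMap hσd x]
      have := hdet x
      rw [← this]
      rfl
  have hdc : Continuous fun x => φ (G x) * (fderiv ℝ G x).det :=
    (hφc.comp hG.continuous).mul
      (ContinuousLinearMap.continuous_det.comp (hG.continuous_fderiv one_ne_zero))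
  have hφi : Integrable φ := hφc.integrable_of_hasCompactSupport hβc
  have hGi : Integrable fun x => φ (G x) * (fderiv ℝ G x).det := by
    have hd : HasCompactSupport fun x => φ (G x) * (fderiv ℝ G x).det := by
      obtain ⟨ρ, hρ⟩ := hβc.isCompact.isBounded.subset_closedBall 0
      refine HasCompactSupport.of_support_subset_isCompact
        (isCompact_closedBall (0 : Eu n) (max (max R 0) ρ)) ?_
      intro x hx
      by_contra hxn
      simp only [mem_closedBall, dist_zero_right, not_le, max_lt_iff] at hxn
      apply hx
      have := (hout x (by simpa using hxn.1)).2.2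
      simp only [this]
      rw [image_eq_zero_of_notMem_tsupport (f := φ), zero_mul]
      intro hxt
      have := hρ hxt
      simp at this
      linarith [hxn.2]
    exact hdc.integrable_of_hasCompactSupport hd
  have hi : ∀ H : Eu n → Eu n, ContDiff ℝ 1 H →
      Integrable fun x => (fderiv ℝ (fun x => l x • H x) x).det := fun H hH => by
    have hc : ContDiff ℝ 1 fun x => l x • H x := hl.smul hH
    refine (ContinuousLinearMap.continuous_det.comp
      (hc.continuous_fderiv one_ne_zero)).integrable_of_hasCompactSupport ?_
    have : HasCompactSupport (fderiv ℝ fun x => l x • H x) :=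
      HasCompactSupport.fderiv (𝕜 := ℝ) l.hasCompactSupport.smul_right
    refine this.comp_left (g := fun A : Eu n →L[ℝ] Eu n => A.det) ?_
    simp [ContinuousLinearMap.det]
  have h3 := integral_sub (hi _ hSG) (hi _ hS)
  simp only [Function.comp_def] at h3
  rw [h1, h2] at h3
  simp only [key] at h3
  rw [integral_sub hGi hφi, integral_prod_coord, hβ1] at h3
  simp at h3
  linarith

theorem exists_injOn_sign_det {E : Type*} [NormedAddCommGroup E] [NormedSpace ℝ E]
    [FiniteDimensional ℝ E] {G : E → E} (hG : ContDiff ℝ 1 G) {z : E}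
    (hz : (fderiv ℝ G z).det ≠ 0) :
    map G (𝓝 z) = 𝓝 (G z) ∧ ∃ U, IsOpen U ∧ z ∈ U ∧ InjOn G U ∧
      ∃ ε : ℤ, Odd ε ∧ ∀ x ∈ U, (fderiv ℝ G x).det = ε * |(fderiv ℝ G x).det| := by
  have := FiniteDimensional.complete ℝ E
  have hs : HasStrictFDerivAt G
      (((fderiv ℝ G z).toContinuousLinearEquivOfDetNeZero hz : E ≃L[ℝ] E) : E →L[ℝ] E) z := by
    simpa using hG.contDiffAt.hasStrictFDerivAt one_ne_zero
  have hcont : Continuous fun x => (fderiv ℝ G x).det :=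
    ContinuousLinearMap.continuous_det.comp (hG.continuous_fderiv one_ne_zero)
  refine ⟨hs.map_nhds_eq_of_equiv, ?_⟩
  have hinj : InjOn G (hs.toOpenPartialHomeomorph G).source :=
    (hs.toOpenPartialHomeomorph G).injOn
  rcases lt_or_gt_of_ne hz with h | h
  · refine ⟨_, (hs.toOpenPartialHomeomorph G).open_source.inter
      (isOpen_lt hcont continuous_const), ⟨hs.mem_toOpenPartialHomeomorph_source, h⟩,
      hinj.mono inter_subset_left, -1, by decide, fun x hx => ?_⟩
    rw [abs_of_neg hx.2]
    simp
  · refine ⟨_, (hs.toOpenPartialHomeomorph G).open_source.inter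
      (isOpen_lt continuous_const hcont), ⟨hs.mem_toOpenPartialHomeomorph_source, h⟩,
      hinj.mono inter_subset_left, 1, by decide, fun x hx => ?_⟩
    rw [abs_of_pos hx.2]
    simp

/-- A concentrated nonnegative product bump. -/
theorem exists_prod_bump {n : ℕ} {N : Set (Eu n)} (hN : N ∈ 𝓝 (0 : Eu n)) :
    ∃ β : ℝ → ℝ, Continuous β ∧ ∫ t, β t = 1 ∧
      HasCompactSupport (fun y : Eu n => ∏ i, β (y i)) ∧ ∀ y ∉ N, ∏ i, β (y i) = 0 := by
  have h0 : (WithLp.toLp 2 : (Fin (n + 1) → ℝ) → Eu n) ⁻¹' N ∈ 𝓝 (0 : Fin (n + 1) → ℝ) :=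
    (PiLp.continuous_toLp 2 (fun _ : Fin (n + 1) => ℝ)).continuousAt.preimage_mem_nhds
      (by simpa using hN)
  obtain ⟨δ, hδ, hb⟩ := Metric.mem_nhds_iff.1 h0
  let l : ContDiffBump (0 : ℝ) := ⟨δ / 2, δ, by positivity, by linarith⟩
  have hout : ∀ y : Eu n, ¬ (∀ i, |y i| < δ) → ∏ i, l.normed volume (y i) = 0 := by
    intro y hy
    push Not at hy
    obtain ⟨i, hi⟩ := hy
    refine Finset.prod_eq_zero (Finset.mem_univ i) ?_
    by_contra hne
    have : y i ∈ Function.support (l.normed volume) := hne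
    rw [l.support_normed_eq] at this
    simp only [mem_ball, dist_zero_right, Real.norm_eq_abs] at this
    exact absurd this (not_lt.2 hi)
  refine ⟨l.normed volume, l.continuous_normed, l.integral_normed, ?_, ?_⟩
  · refine HasCompactSupport.of_support_subset_isCompact
      ((isCompact_closedBall (0 : Fin (n + 1) → ℝ) δ).image
        (PiLp.continuous_toLp 2 (fun _ : Fin (n + 1) => ℝ))) fun y hy => ?_
    have : ∀ i, |y i| < δ := by
      by_contra h
      exact hy (hout y h)
    refine ⟨WithLp.ofLp y, ?_, rfl⟩
    rw [mem_closedBall, dist_zero_right, pi_norm_le_iff_of_nonneg hδ.le]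
    exact fun i => (this i).le
  · intro y hy
    refine hout y fun h => hy ?_
    have : WithLp.ofLp y ∈ ball (0 : Fin (n + 1) → ℝ) δ := by
      rw [mem_ball, dist_zero_right, pi_norm_lt_iff hδ]
      exact h
    exact hb this

/-- A `C¹` map which is the identity near infinity and has only nondegenerate zeros has an
odd number of zeros. -/
theorem odd_ncard_zeros {n : ℕ} {G : Eu n → Eu n} (hG : ContDiff ℝ 1 G) {R : ℝ}
    (hGR : ∀ x, R ≤ ‖x‖ → G x = x) (hreg : ∀ x, G x = 0 → (fderiv ℝ G x).det ≠ 0) :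
    {x | G x = 0}.Finite ∧ Odd {x | G x = 0}.ncard := by
  set Z := {x | G x = 0} with hZ
  have hZc : IsCompact Z := by
    refine Metric.isCompact_of_isClosed_isBounded (isClosed_eq hG.continuous continuous_const) ?_
    refine (Metric.isBounded_closedBall (x := (0 : Eu n)) (r := max R 0)).subset fun x hx => ?_
    rw [mem_closedBall, dist_zero_right]
    by_contra h
    rw [not_le, max_lt_iff] at h
    have : x = 0 := by rw [← hGR x h.1.le]; exact hx
    simp [this] at h
  choose! U hUo hzU hUi ε hε hUε using
    fun z (hz : z ∈ Z) => (exists_injOn_sign_det hG (hreg z hz)).2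
  have hfin : Z.Finite := by
    obtain ⟨t, htZ, ht⟩ := hZc.elim_nhds_subcover U fun z hz => (hUo z hz).mem_nhds (hzU z hz)
    refine t.finite_toSet.subset fun x hx => ?_
    obtain ⟨z, hzt, hxz⟩ := mem_iUnion₂.1 (ht hx)
    have hz := htZ z hzt
    have : x = z := hUi z hz hxz (hzU z hz) (hx.trans hz.symm)
    rwa [this]
  refine ⟨hfin, ?_⟩
  obtain ⟨V, hV, hVd⟩ := hfin.t2_separation
  set W : Eu n → Set (Eu n) := fun z => U z ∩ V z with hW
  have hWo : ∀ z ∈ Z, IsOpen (W z) := fun z hz => (hUo z hz).inter (hV z).2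
  have hzW : ∀ z ∈ Z, z ∈ W z := fun z hz => ⟨hzU z hz, (hV z).1⟩
  set R' := max R 0 + 1
  set A := closedBall (0 : Eu n) R' \ ⋃ z ∈ Z, W z with hA
  have hAc : IsCompact A :=
    (isCompact_closedBall _ _).diff (isOpen_biUnion hWo)
  have hN : ((⋂ z ∈ Z, G '' W z) ∩ (G '' A)ᶜ ∩ ball 0 1) ∈ 𝓝 (0 : Eu n) := by
    refine inter_mem (inter_mem ((biInter_mem hfin).2 fun z hz => ?_) ?_) (ball_mem_nhds _ one_pos)
    · have := (exists_injOn_sign_det hG (hreg z hz)).1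
      rw [show G z = 0 from hz] at this
      rw [← this]
      exact image_mem_map ((hWo z hz).mem_nhds (hzW z hz))
    · refine (hAc.image hG.continuous).isClosed.isOpen_compl.mem_nhds ?_
      rintro ⟨x, hx, hx0⟩
      exact hx.2 (mem_biUnion (show x ∈ Z from hx0) (hzW x hx0))
  obtain ⟨β, hβ, hβ1, hβc, hβN⟩ := exists_prod_bump hN
  have hint := integral_prod_comp_mul_det_fderiv hβ hβ1 hG hGR hβc
  set φ : Eu n → ℝ := fun y => ∏ i, β (y i) with hφ
  have hout : ∀ x, x ∉ ⋃ z ∈ hfin.toFinset, W z → φ (G x) * (fderiv ℝ G x).det = 0 := by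
    intro x hx
    simp only [Finite.mem_toFinset] at hx
    rw [show φ (G x) = 0 from hβN _ ?_, zero_mul]
    rintro ⟨⟨-, h2⟩, h3⟩
    by_cases hxR : ‖x‖ ≤ R'
    · exact h2 ⟨x, ⟨by simpa using hxR, hx⟩, rfl⟩
    · rw [not_le] at hxR
      rw [hGR x (by linarith [le_max_left R 0])] at h3
      simp at h3
      linarith [le_max_right R 0]
  have hWi : ∀ z ∈ Z, ∫ x in W z, φ (G x) * (fderiv ℝ G x).det = ε z := by
    intro z hz
    have h1 := integral_image_eq_integral_abs_det_fderiv_smul volume (hWo z hz).measurableSet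
      (fun x _ => (hG.differentiable one_ne_zero x).hasFDerivAt.hasFDerivWithinAt)
      ((hUi z hz).mono inter_subset_left) φ
    have h2 : ∫ x in G '' W z, φ x = 1 := by
      rw [setIntegral_eq_integral_of_forall_compl_eq_zero, integral_prod_coord, hβ1, one_pow]
      intro x hx
      refine hβN x fun h => hx ?_
      exact mem_iInter₂.1 h.1.1 z hz
    rw [h2] at h1
    have h3 : ∫ x in W z, φ (G x) * (fderiv ℝ G x).det =
        ∫ x in W z, (ε z : ℝ) * (|(fderiv ℝ G x).det| • φ (G x)) := by
      refine setIntegral_congr_fun (hWo z hz).measurableSet fun x hx => ?_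
      have := hUε z hz x hx.1
      simp only [smul_eq_mul]
      nth_rewrite 1 [this]
      ring
    rw [h3, integral_const_mul, ← h1, mul_one]
  have hint2 : ∫ x, φ (G x) * (fderiv ℝ G x).det = ∑ z ∈ hfin.toFinset, (ε z : ℝ) := by
    rw [← setIntegral_eq_integral_of_forall_compl_eq_zero hout, integral_biUnion_finset]
    · exact Finset.sum_congr rfl fun z hz => hWi z (by simpa using hz)
    · exact fun z hz => (hWo z (by simpa using hz)).measurableSet
    · intro z hz z' hz' hne
      exact (hVd (by simpa using hz) (by simpa using hz') hne).mono inter_subset_right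
        inter_subset_right
    · intro z hz
      by_contra h
      have := integral_undef h
      rw [hWi z (by simpa using hz)] at this
      have h0 : ε z = 0 := by exact_mod_cast this
      have := hε z (by simpa using hz)
      rw [h0] at this
      exact absurd this (by decide)
  have hsum : ∑ z ∈ hfin.toFinset, ε z = 1 := by
    have : (∑ z ∈ hfin.toFinset, (ε z : ℝ)) = 1 := hint2.symm.trans hint
    exact_mod_cast this
  rw [ncard_eq_toFinset_card Z hfin]
  have h2 := congrArg (Int.cast : ℤ → ZMod 2) hsum
  push_cast at h2
  rw [Finset.sum_congr rfl (g := fun _ => (1 : ZMod 2)) fun z hz => ?_] at h2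
  · simp only [Finset.sum_const, nsmul_eq_mul, mul_one] at h2
    exact (ZMod.natCast_eq_one_iff_odd).1 h2
  · obtain ⟨k, hk⟩ := hε z (by simpa using hz)
    rw [hk]
    push_cast
    rw [show (2 : ZMod 2) = 0 from rfl]
    simp

section TwistedFields

variable {E : Type*} [NormedAddCommGroup E] [InnerProductSpace ℝ E]

/-- The reflection in the hyperplane orthogonal to `x`. -/
def reflAlong (x y : E) : E := y - (2 * ⟪x, y⟫ / ‖x‖ ^ 2) • x

theorem norm_reflAlong (x y : E) : ‖reflAlong x y‖ = ‖y‖ := by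
  rcases eq_or_ne x 0 with rfl | hx
  · simp [reflAlong]
  have hx' : ‖x‖ ≠ 0 := norm_ne_zero_iff.2 hx
  rw [← sq_eq_sq₀ (norm_nonneg _) (norm_nonneg _), reflAlong, norm_sub_sq_real, inner_smul_right,
    norm_smul, mul_pow, real_inner_comm x y, Real.norm_eq_abs, sq_abs]
  field_simp
  ring

theorem reflAlong_add (x y z : E) : reflAlong x (y + z) = reflAlong x y + reflAlong x z := by
  simp only [reflAlong, inner_add_right, mul_add, add_div, add_smul]
  abel

theorem reflAlong_smul (x y : E) (c : ℝ) : reflAlong x (c • y) = c • reflAlong x y := by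
  simp only [reflAlong, inner_smul_right, smul_sub, smul_smul]
  congr 2
  ring

theorem reflAlong_sub (x y z : E) : reflAlong x (y - z) = reflAlong x y - reflAlong x z := by
  simp only [reflAlong, inner_sub_right, mul_sub, sub_div, sub_smul]
  abel

theorem reflAlong_neg_left (x y : E) : reflAlong (-x) y = reflAlong x y := by
  simp [reflAlong, neg_div]

theorem reflAlong_self (x : E) : reflAlong x x = -x := by
  rcases eq_or_ne x 0 with rfl | hx
  · simp [reflAlong]
  have hx' : ‖x‖ ≠ 0 := norm_ne_zero_iff.2 hx
  rw [reflAlong, real_inner_self_eq_norm_sq, mul_div_cancel_right₀ _ (pow_ne_zero 2 hx'), two_smul]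
  abel

theorem reflAlong_reflAlong (x y : E) : reflAlong x (reflAlong x y) = y := by
  nth_rewrite 2 [reflAlong]
  rw [reflAlong_sub, reflAlong_smul, reflAlong_self, reflAlong]
  simp

/-- The equivariant vector fields used as perturbations. -/
def twistField (x : E) (q : E × ℝ) : E := ‖x‖ ^ 2 • q.1 + (q.2 - ⟪q.1, x⟫) • x

theorem twistField_neg {x : E} (hx : x ≠ 0) (q : E × ℝ) :
    twistField (-x) q = reflAlong x (twistField x q) := by
  have hx' : ‖x‖ ≠ 0 := norm_ne_zero_iff.2 hx
  rw [twistField, twistField, reflAlong_add, reflAlong_smul, reflAlong_smul, reflAlong_self,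
    reflAlong, smul_sub, smul_smul, mul_div_cancel₀ _ (pow_ne_zero 2 hx'), real_inner_comm]
  simp only [norm_neg, inner_neg_left, sub_neg_eq_add, real_inner_comm x q.1]
  module

theorem contDiff_twistField : ContDiff ℝ 1 fun z : E × (E × ℝ) => twistField z.1 z.2 := by
  unfold twistField
  have h1 : ContDiff ℝ 1 fun z : E × (E × ℝ) => ‖z.1‖ ^ 2 := (contDiff_fst).norm_sq ℝ
  have h2 : ContDiff ℝ 1 fun z : E × (E × ℝ) => (⟪z.2.1, z.1⟫ : ℝ) :=
    (contDiff_snd.fst).inner ℝ contDiff_fst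
  exact (h1.smul contDiff_snd.fst).add ((contDiff_snd.snd.sub h2).smul contDiff_fst)

theorem contDiff_twistField_left (q : E × ℝ) : ContDiff ℝ 1 fun x : E => twistField x q := by
  unfold twistField
  have h1 : ContDiff ℝ 1 fun x : E => ‖x‖ ^ 2 := contDiff_norm_sq ℝ
  have h2 : ContDiff ℝ 1 fun x : E => q.2 - ⟪q.1, x⟫ :=
    contDiff_const.sub (contDiff_const.inner ℝ contDiff_id)
  exact (h1.smul contDiff_const).add (h2.smul contDiff_id)

theorem norm_twistField_le (x : E) (q : E × ℝ) :
    ‖twistField x q‖ ≤ 2 * ‖x‖ ^ 2 * ‖q.1‖ + |q.2| * ‖x‖ := by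
  have h1 : ‖twistField x q‖ ≤ ‖x‖ ^ 2 * ‖q.1‖ + |q.2 - ⟪q.1, x⟫| * ‖x‖ := by
    refine (norm_add_le _ _).trans_eq ?_
    rw [norm_smul, norm_smul, norm_pow, norm_norm, Real.norm_eq_abs]
  have h2 : |q.2 - ⟪q.1, x⟫| ≤ |q.2| + ‖q.1‖ * ‖x‖ :=
    (abs_sub _ _).trans (by gcongr; exact abs_real_inner_le_norm _ _)
  nlinarith [norm_nonneg x]

end TwistedFields

/-- Small equivariant perturbations make all zeros away from the origin nondegenerate. -/
theorem exists_twistField_regular {n : ℕ} {F : Eu n → Eu n} (hF : ContDiff ℝ 1 F) {ε : ℝ}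
    (hε : 0 < ε) : ∃ q : Eu n × ℝ, ‖q‖ < ε ∧ ∀ x ≠ 0, F x + twistField x q = 0 →
      (fderiv ℝ (fun x => F x + twistField x q) x).det ≠ 0 := by
  set Φ : Eu n × ℝ → Eu n × ℝ := fun z =>
    ((‖z.1‖ ^ 2)⁻¹ • (z.2 • z.1 - F z.1), -((‖z.1‖ ^ 2)⁻¹ * ⟪F z.1, z.1⟫)) with hΦ
  set D : Set (Eu n × ℝ) := {z | z.1 ≠ 0 ∧ (fderiv ℝ Φ z).det = 0} with hD
  have hΦd : ∀ z : Eu n × ℝ, z.1 ≠ 0 → DifferentiableAt ℝ Φ z := by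
    intro z hz
    have h0 : ‖z.1‖ ^ 2 ≠ 0 := by simpa using hz
    have h1 : DifferentiableAt ℝ (fun z : Eu n × ℝ => ‖z.1‖ ^ 2) z :=
      (differentiableAt_fst).norm_sq ℝ
    have h2 : DifferentiableAt ℝ (fun z : Eu n × ℝ => F z.1) z :=
      (hF.differentiable one_ne_zero _).comp z differentiableAt_fst
    have h3 : DifferentiableAt ℝ (fun z : Eu n × ℝ => (‖z.1‖ ^ 2)⁻¹) z := h1.fun_inv h0
    have h4 : DifferentiableAt ℝ (fun z : Eu n × ℝ => z.2 • z.1 - F z.1) z :=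
      (differentiableAt_snd.fun_smul differentiableAt_fst).fun_sub h2
    have h5 : DifferentiableAt ℝ (fun z : Eu n × ℝ => (⟪F z.1, z.1⟫ : ℝ)) z :=
      h2.inner ℝ differentiableAt_fst
    exact (h3.fun_smul h4).prodMk (h3.fun_mul h5).fun_neg
  have hnull : (volume : Measure (Eu n × ℝ)) (Φ '' D) = 0 := by
    have : (volume : Measure (Eu n × ℝ)).IsAddHaarMeasure :=
      Measure.prod.instIsAddHaarMeasure _ _
    exact addHaar_image_eq_zero_of_det_fderivWithin_eq_zero volume
      (fun z hz => (hΦd z hz.1).hasFDerivAt.hasFDerivWithinAt) fun z hz => hz.2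
  obtain ⟨q, hqD, hqε⟩ : ∃ q, q ∉ Φ '' D ∧ q ∈ ball (0 : Eu n × ℝ) ε := by
    by_contra! h
    have hsub : ball (0 : Eu n × ℝ) ε ⊆ Φ '' D := fun q hq => by
      by_contra hq'
      exact h q hq' hq
    exact (measure_ball_pos volume (0 : Eu n × ℝ) hε).ne' (measure_mono_null hsub hnull)
  refine ⟨q, by simpa using hqε, fun x hx hzero => ?_⟩
  have hx2 : ‖x‖ ^ 2 ≠ 0 := by simpa using hx
  set z : Eu n × ℝ := (x, ⟪q.1, x⟫ - q.2)
  have hzq : Φ z = q := by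
    have hFx : F x = -twistField x q := eq_neg_of_add_eq_zero_left hzero
    ext1
    · simp only [hΦ, z, hFx, twistField]
      rw [show (⟪q.1, x⟫ - q.2) • x - -(‖x‖ ^ 2 • q.1 + (q.2 - ⟪q.1, x⟫) • x) = ‖x‖ ^ 2 • q.1 by
        module, smul_smul, inv_mul_cancel₀ hx2, one_smul]
    · simp only [hΦ, z, hFx, twistField, inner_neg_left, inner_add_left, inner_smul_left,
        real_inner_self_eq_norm_sq, conj_trivial]
      field_simp
      ring
  have hzdet : (fderiv ℝ Φ z).det ≠ 0 := fun h => hqD ⟨z, ⟨hx, h⟩, hzq⟩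
  set Ψ : Eu n × (Eu n × ℝ) → Eu n := fun y => F y.1 + twistField y.1 y.2 with hΨ
  have hΨc : ContDiff ℝ 1 Ψ := (hF.comp contDiff_fst).add contDiff_twistField
  have hΨd := (hΨc.differentiable one_ne_zero (x, q)).hasFDerivAt
  set L := fderiv ℝ Ψ (x, q)
  have hcomp1 : HasFDerivAt (fun x => F x + twistField x q)
      (L ∘L ContinuousLinearMap.inl ℝ (Eu n) (Eu n × ℝ)) x :=
    HasFDerivAt.comp (g := Ψ) (f := fun y => (y, q)) x hΨd (hasFDerivAt_prodMk_left x q)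
  have hcomp2 : ∀ h k, L (h, fderiv ℝ Φ z (h, k)) = 0 := by
    have h1 : HasFDerivAt (fun y : Eu n × ℝ => (y.1, Φ y))
        ((ContinuousLinearMap.fst ℝ (Eu n) ℝ).prod (fderiv ℝ Φ z)) z :=
      hasFDerivAt_fst.prodMk (hΦd z hx).hasFDerivAt
    have h2 : HasFDerivAt (fun y : Eu n × ℝ => Ψ (y.1, Φ y))
        (L ∘L ((ContinuousLinearMap.fst ℝ (Eu n) ℝ).prod (fderiv ℝ Φ z))) z := by
      refine HasFDerivAt.comp (g := Ψ) (f := fun y : Eu n × ℝ => (y.1, Φ y)) z ?_ h1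
      rw [hzq]
      exact hΨd
    have h3 : (fun y : Eu n × ℝ => Ψ (y.1, Φ y)) =ᶠ[𝓝 z] fun _ => 0 := by
      have : ∀ᶠ y : Eu n × ℝ in 𝓝 z, y.1 ≠ 0 :=
        continuous_fst.continuousAt.eventually_ne hx
      filter_upwards [this] with y hy
      have hy2 : ‖y.1‖ ^ 2 ≠ 0 := by simpa using hy
      simp only [hΨ, hΦ, twistField, smul_smul, mul_inv_cancel₀ hy2, one_smul, inner_smul_left,
        inner_sub_left, real_inner_self_eq_norm_sq, conj_trivial]
      rw [show -((‖y.1‖ ^ 2)⁻¹ * ⟪F y.1, y.1⟫) -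
        (‖y.1‖ ^ 2)⁻¹ * (y.2 * ‖y.1‖ ^ 2 - ⟪F y.1, y.1⟫) = -y.2 by field_simp; ring]
      module
    intro h k
    exact DFunLike.congr_fun (h2.unique (h3.hasFDerivAt_iff.2 (hasFDerivAt_const 0 z))) (h, k)
  have hinr : ∀ e : Eu n, L (0, ((‖x‖ ^ 2)⁻¹ • e, (‖x‖ ^ 2)⁻¹ * ⟪e, x⟫)) = e := by
    intro e
    set d : Eu n × ℝ := ((‖x‖ ^ 2)⁻¹ • e, (‖x‖ ^ 2)⁻¹ * ⟪e, x⟫)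
    have h1 : HasDerivAt (fun t : ℝ => Ψ (x, q + t • d)) (L (0, d)) 0 := by
      have h2 : HasDerivAt (fun t : ℝ => (x, q + t • d)) ((0 : Eu n), d) 0 := by
        refine (hasDerivAt_const _ _).prodMk ?_
        simpa using ((hasDerivAt_id (0 : ℝ)).smul_const d).const_add q
      refine HasFDerivAt.comp_hasDerivAt (l := Ψ) (f := fun t : ℝ => (x, q + t • d)) 0 ?_ h2
      simpa using hΨd
    have h2 : ∀ t : ℝ, Ψ (x, q + t • d) = Ψ (x, q) + t • e := by
      intro t
      simp only [hΨ, twistField, d, Prod.fst_add, Prod.snd_add, Prod.smul_fst, Prod.smul_snd,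
        inner_add_left, inner_smul_left, conj_trivial, smul_add, smul_smul, smul_eq_mul,
        show ‖x‖ ^ 2 * (t * (‖x‖ ^ 2)⁻¹) = t by field_simp]
      module
    have h3 : HasDerivAt (fun t : ℝ => Ψ (x, q + t • d)) e 0 := by
      simp only [h2]
      simpa using ((hasDerivAt_id (0 : ℝ)).smul_const e).const_add (Ψ (x, q))
    exact h1.unique h3
  rw [hcomp1.fderiv]
  have hsurj : Function.Surjective (fderiv ℝ Φ z) :=
    ((fderiv ℝ Φ z).toContinuousLinearEquivOfDetNeZero hzdet).surjective
  have hLs : Function.Surjective (L ∘L ContinuousLinearMap.inl ℝ (Eu n) (Eu n × ℝ)) := by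
    intro e
    obtain ⟨⟨h, k⟩, hhk⟩ := hsurj ((‖x‖ ^ 2)⁻¹ • (-e), (‖x‖ ^ 2)⁻¹ * ⟪-e, x⟫)
    refine ⟨h, ?_⟩
    have h0 := hcomp2 h k
    rw [hhk, show ∀ u : Eu n × ℝ, (h, u) = (h, 0) + (0, u) from fun u => by simp, map_add,
      hinr] at h0
    simpa using eq_neg_of_add_eq_zero_left h0
  intro hdet
  have := LinearMap.bot_lt_ker_of_det_eq_zero (f := ((L ∘L ContinuousLinearMap.inl ℝ (Eu n)
    (Eu n × ℝ) : Eu n →L[ℝ] Eu n) : Eu n →ₗ[ℝ] Eu n)) hdet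
  rw [LinearMap.ker_eq_bot.2 (LinearMap.injective_iff_surjective.2 hLs)] at this
  exact lt_irrefl _ this

theorem even_ncard_of_neg_mem {E : Type*} [AddCommGroup E] [Module ℝ E] {Z : Set E}
    (hZ : Z.Finite) (h0 : (0 : E) ∉ Z) (hneg : ∀ x ∈ Z, -x ∈ Z) : Even Z.ncard := by
  have h := Finset.sum_involution (s := hZ.toFinset) (f := fun _ => (1 : ZMod 2))
    (fun x _ => -x) (fun _ _ => rfl)
    (fun x hx _ hxx => h0 (by
      have : x = 0 := by
        have h2 : (2 : ℝ) • x = 0 := by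
          rw [two_smul]
          nth_rewrite 1 [← hxx]
          exact neg_add_cancel x
        exact (smul_eq_zero.1 h2).resolve_left two_ne_zero
      rw [← this]
      simpa using hx))
    (fun x hx => by simpa using hneg x (by simpa using hx)) (fun x _ => neg_neg x)
  rw [ncard_eq_toFinset_card Z hZ]
  simp only [Finset.sum_const, nsmul_eq_mul, mul_one] at h
  exact (ZMod.natCast_eq_zero_iff_even).1 h

theorem contDiffAt_reflAlong {E F : Type*} [NormedAddCommGroup E] [InnerProductSpace ℝ E]
    [NormedAddCommGroup F] [NormedSpace ℝ F] {f g : F → E} {x : F} {k : WithTop ℕ∞}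
    (hf : ContDiffAt ℝ k f x) (hg : ContDiffAt ℝ k g x) (hx : f x ≠ 0) :
    ContDiffAt ℝ k (fun y => reflAlong (f y) (g y)) x := by
  unfold reflAlong
  refine hg.sub (ContDiffAt.smul (ContDiffAt.div (contDiffAt_const.mul (hf.inner ℝ hg))
    (hf.norm_sq ℝ) ?_) hf)
  simpa using hx

theorem exists_radial_bump (n : ℕ) {a b : ℝ} (ha : 0 < a) (hab : a < b) :
    ∃ χ : Eu n → ℝ, ContDiff ℝ 1 χ ∧ (∀ x, ‖x‖ ≤ a → χ x = 1) ∧ (∀ x, b ≤ ‖x‖ → χ x = 0) ∧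
      (∀ x, 0 ≤ χ x) ∧ (∀ x, χ x ≤ 1) ∧ ∀ x, χ (-x) = χ x :=
  let χ : ContDiffBump (0 : Eu n) := ⟨a, b, ha, hab⟩
  ⟨χ, χ.contDiff, fun _ hx => χ.one_of_mem_closedBall (by simpa using hx),
    fun _ hx => χ.zero_of_le_dist (by simpa using hx), fun _ => χ.nonneg, fun _ => χ.le_one, χ.neg⟩

/-- There is no unit field on `ℝ^{n+1}` which is equivariant outside the unit ball. -/
theorem not_exists_twisted_extension {n : ℕ} (N : Eu n → Eu n) (hN : Continuous N)
    (hN1 : ∀ x, ‖N x‖ = 1) (hsymm : ∀ x, 1 ≤ ‖x‖ → N (-x) = reflAlong x (N x)) : False := by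
  obtain ⟨K, hK, hKN, -⟩ := hN.exists_contDiff_approx 1 (ε := fun _ => 1 / 4) continuous_const
    fun _ => by norm_num
  simp only [dist_eq_norm] at hKN
  replace hK : ContDiff ℝ 1 K := by exact_mod_cast hK
  obtain ⟨χ, hχc, hχ1, hχ0, hχn, hχl, -⟩ := exists_radial_bump n one_pos one_lt_two
  obtain ⟨α, hαc, hα1, hα0, -, -, hαneg⟩ :=
    exists_radial_bump n two_pos (show (2 : ℝ) < 3 by norm_num)
  obtain ⟨θ, hθc, hθ1, hθ0, hθn, hθl, hθneg⟩ := exists_radial_bump n three_pos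
    (show (3 : ℝ) < 4 by norm_num)
  -- symmetrized approximation
  set S : Eu n → Eu n := fun x => (1 / 2 : ℝ) • (K x + reflAlong x (K (-x))) with hS
  set K' : Eu n → Eu n := fun x => χ x • K x + (1 - χ x) • S x with hK'
  have hK'c : ContDiff ℝ 1 K' := by
    rw [contDiff_iff_contDiffAt]
    intro x
    rcases eq_or_ne x 0 with rfl | hx
    · refine hK.contDiffAt.congr_of_eventuallyEq ?_
      filter_upwards [ball_mem_nhds (0 : Eu n) one_pos] with y hy
      simp [hK', hχ1 y (le_of_lt (by simpa using hy))]
    · have h1 : ContDiffAt ℝ 1 χ x := hχc.contDiffAt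
      have h3 : ContDiffAt ℝ 1 (fun y => K (-y)) x := (hK.comp contDiff_neg).contDiffAt
      have h4 : ContDiffAt ℝ 1 (fun y => reflAlong y (K (-y))) x :=
        contDiffAt_reflAlong contDiffAt_id h3 hx
      have h2 : ContDiffAt ℝ 1 S x := (hK.contDiffAt.add h4).const_smul (1 / 2 : ℝ)
      have h5 : ContDiffAt ℝ 1 (fun y => 1 - χ y) x := contDiffAt_const.sub h1
      exact (h1.smul hK.contDiffAt).add (h5.smul h2)
  have hSN : ∀ x, 1 ≤ ‖x‖ → ‖S x - N x‖ ≤ 1 / 4 := by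
    intro x hx
    have h1 : N x = reflAlong x (N (-x)) := by rw [hsymm x hx, reflAlong_reflAlong]
    have h2 : S x - N x = (1 / 2 : ℝ) • ((K x - N x) + reflAlong x (K (-x) - N (-x))) := by
      rw [reflAlong_sub, ← h1]
      simp only [hS]
      module
    rw [h2, norm_smul]
    have h3 := norm_add_le (K x - N x) (reflAlong x (K (-x) - N (-x)))
    rw [norm_reflAlong] at h3
    have h4 := hKN x
    have h5 := hKN (-x)
    norm_num
    linarith
  have hK'N : ∀ x, ‖K' x - N x‖ ≤ 1 / 4 := by
    intro x
    rcases le_total ‖x‖ 1 with hx | hx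
    · simp only [hK', hχ1 x hx]
      simpa using (hKN x).le
    · have h1 : K' x - N x = χ x • (K x - N x) + (1 - χ x) • (S x - N x) := by
        simp only [hK']
        module
      have h2 := hSN x hx
      have h3 := hKN x
      have h4 : 0 ≤ χ x := hχn x
      have h5 : 0 ≤ 1 - χ x := sub_nonneg.2 (hχl x)
      rw [h1]
      refine (norm_add_le _ _).trans ?_
      rw [norm_smul, norm_smul, Real.norm_of_nonneg h4, Real.norm_of_nonneg h5]
      nlinarith
  -- interpolation with the identity
  set F : Eu n → Eu n := fun x => α x • K' x + (1 - α x) • x with hF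
  have hα' : ContDiff ℝ 1 fun x => 1 - α x := contDiff_const.sub hαc
  have hFc : ContDiff ℝ 1 F := (hαc.smul hK'c).add (hα'.smul contDiff_id)
  obtain ⟨q, hq, hreg⟩ := exists_twistField_regular hFc (ε := 1 / 72) (by norm_num)
  set G : Eu n → Eu n := fun x => F x + θ x • twistField x q with hG
  have hGc : ContDiff ℝ 1 G := hFc.add (hθc.smul (contDiff_twistField_left q))
  have hGout : ∀ x, 4 ≤ ‖x‖ → G x = x := by
    intro x hx
    simp [hG, hF, hθ0 x hx, hα0 x (by linarith)]
  have hsmall : ∀ x, ‖θ x • twistField x q‖ ≤ 1 / 2 := by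
    intro x
    rcases le_total 4 ‖x‖ with hx | hx
    · rw [hθ0 x hx, zero_smul, norm_zero]
      norm_num
    · rw [norm_smul, Real.norm_of_nonneg (hθn x)]
      have h1 := norm_twistField_le x q
      have h2 : ‖q.1‖ ≤ 1 / 72 := (norm_fst_le q).trans hq.le
      have h3 : |q.2| ≤ 1 / 72 := (norm_snd_le q).trans hq.le
      have h4 : ‖twistField x q‖ ≤ 1 / 2 := by
        refine h1.trans ?_
        calc 2 * ‖x‖ ^ 2 * ‖q.1‖ + |q.2| * ‖x‖ ≤ 2 * 4 ^ 2 * (1 / 72) + (1 / 72) * 4 := by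
              gcongr
          _ = 1 / 2 := by norm_num
      have h5 : θ x ≤ 1 := hθl x
      have h6 : 0 ≤ θ x := hθn x
      nlinarith [norm_nonneg (twistField x q)]
  have hzero : ∀ x, G x = 0 → 2 < ‖x‖ ∧ ‖x‖ < 3 := by
    intro x hx
    have h1 : ‖F x‖ ≤ 1 / 2 := by
      have : F x = -(θ x • twistField x q) := eq_neg_of_add_eq_zero_left hx
      rw [this, norm_neg]
      exact hsmall x
    constructor
    · by_contra! h
      have h2 : F x = K' x := by simp [hF, hα1 x h]
      rw [h2] at h1
      have h3 := norm_sub_norm_le (N x) (K' x)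
      rw [norm_sub_rev, hN1] at h3
      linarith [hK'N x]
    · by_contra! h
      have h2 : F x = x := by simp [hF, hα0 x h]
      rw [h2] at h1
      linarith
  have hGreg : ∀ x, G x = 0 → (fderiv ℝ G x).det ≠ 0 := by
    intro x hx
    obtain ⟨h2, h3⟩ := hzero x hx
    have hev : G =ᶠ[𝓝 x] fun x => F x + twistField x q := by
      filter_upwards [(isOpen_lt continuous_norm continuous_const).mem_nhds h3] with y hy
      simp [hG, hθ1 y (le_of_lt hy)]
    rw [hev.fderiv_eq]
    refine hreg x (fun h => by simp [h] at h2; linarith) ?_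
    rw [← hx, hev.eq_of_nhds]
  have hGs : ∀ x, 2 ≤ ‖x‖ → G (-x) = reflAlong x (G x) := by
    intro x hx
    have hx0 : x ≠ 0 := fun h => by simp [h] at hx; linarith
    have hK's : K' (-x) = reflAlong x (K' x) := by
      simp only [hK', hχ0 x hx, hχ0 (-x) (by simpa using hx), hS, zero_smul, zero_add, sub_zero,
        one_smul, neg_neg, reflAlong_smul, reflAlong_add, reflAlong_reflAlong, reflAlong_neg_left]
      rw [add_comm (K (-x))]
    simp only [hG, hF, hαneg, hθneg, reflAlong_add, reflAlong_smul, hK's, twistField_neg hx0,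
      reflAlong_self]
  obtain ⟨hfin, hodd⟩ := odd_ncard_zeros hGc hGout hGreg
  refine (Nat.not_even_iff_odd.2 hodd) (even_ncard_of_neg_mem hfin ?_ ?_)
  · intro h
    have := (hzero 0 h).1
    simp at this
    linarith
  · intro x hx
    have h := hGs x (hzero x hx).1.le
    rw [show G x = 0 from hx] at h
    simpa [reflAlong] using h

section Moebius

variable {n : ℕ}

/-- The conformal factor of `dMap ξ` on the unit sphere. -/
def rho (ξ x : Eu n) : ℝ := (1 - ‖ξ‖ ^ 2) / (1 + 2 * ⟪ξ, x⟫ + ‖ξ‖ ^ 2)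

/-- `T` maps the unit sphere to itself and is conformal there, with conformal factor `ρ`. -/
structure IsConf (T : Eu n → Eu n) (ρ : Eu n → ℝ) : Prop where
  measurable : Measurable T
  measurable_factor : Measurable ρ
  norm_eq : ∀ x, ‖x‖ = 1 → ‖T x‖ = 1
  pos : ∀ x, ‖x‖ = 1 → 0 < ρ x
  bdd : ∃ C, ∀ x, ‖x‖ = 1 → ρ x ≤ C
  one_sub_inner : ∀ x y, ‖x‖ = 1 → ‖y‖ = 1 → 1 - ⟪T x, T y⟫ = ρ x * ρ y * (1 - ⟪x, y⟫)

theorem IsConf.comp {T U : Eu n → Eu n} {ρ κ : Eu n → ℝ} (hU : IsConf U κ) (hT : IsConf T ρ) :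
    IsConf (U ∘ T) fun x => κ (T x) * ρ x where
  measurable := hU.measurable.comp hT.measurable
  measurable_factor := (hU.measurable_factor.comp hT.measurable).mul hT.measurable_factor
  norm_eq x hx := hU.norm_eq _ (hT.norm_eq x hx)
  pos x hx := mul_pos (hU.pos _ (hT.norm_eq x hx)) (hT.pos x hx)
  bdd := by
    obtain ⟨C, hC⟩ := hT.bdd
    obtain ⟨C', hC'⟩ := hU.bdd
    refine ⟨C' * C, fun x hx => ?_⟩
    exact mul_le_mul (hC' _ (hT.norm_eq x hx)) (hC x hx) (hT.pos x hx).le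
      ((hU.pos _ (hT.norm_eq x hx)).le.trans (hC' _ (hT.norm_eq x hx)))
  one_sub_inner x y hx hy := by
    rw [Function.comp, Function.comp, hU.one_sub_inner _ _ (hT.norm_eq x hx) (hT.norm_eq y hy),
      hT.one_sub_inner x y hx hy]
    ring

theorem dMap_denom_pos {ξ x : Eu n} (hξ : ‖ξ‖ < 1) (hx : ‖x‖ = 1) :
    0 < 1 + 2 * ⟪ξ, x⟫ + ‖ξ‖ ^ 2 := by
  have h := (abs_le.1 (abs_real_inner_le_norm ξ x)).1
  rw [hx, mul_one] at h
  nlinarith [norm_nonneg ξ]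

theorem one_sub_norm_sq_pos {ξ : Eu n} (hξ : ‖ξ‖ < 1) : 0 < 1 - ‖ξ‖ ^ 2 := by
  nlinarith [norm_nonneg ξ]

theorem inner_dMap (ξ y : Eu n) {x : Eu n} (hx : ‖x‖ = 1) :
    ⟪y, dMap ξ x⟫ = ((1 - ‖ξ‖ ^ 2) * ⟪y, x⟫ + (2 + 2 * ⟪ξ, x⟫) * ⟪y, ξ⟫) /
      (1 + 2 * ⟪ξ, x⟫ + ‖ξ‖ ^ 2) := by
  rw [dMap, inner_smul_right, inner_add_right, inner_smul_right, inner_smul_right, hx]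
  ring

theorem measurable_dMap (ξ : Eu n) : Measurable (dMap ξ) := by
  unfold dMap
  fun_prop

theorem isConf_dMap {ξ : Eu n} (hξ : ‖ξ‖ < 1) : IsConf (dMap ξ) (rho ξ) := by
  have key : ∀ x y : Eu n, ‖x‖ = 1 → ‖y‖ = 1 →
      1 - ⟪dMap ξ x, dMap ξ y⟫ = rho ξ x * rho ξ y * (1 - ⟪x, y⟫) := by
    intro x y hx hy
    rw [inner_dMap _ _ hy, real_inner_comm, inner_dMap _ _ hx, real_inner_comm ξ (dMap ξ x),
      inner_dMap _ _ hx, real_inner_self_eq_norm_sq, rho, rho, real_inner_comm x y,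
      real_inner_comm ξ y]
    have h1 := (dMap_denom_pos hξ hx).ne'
    have h2 := (dMap_denom_pos hξ hy).ne'
    field_simp
    ring
  refine ⟨measurable_dMap ξ, ?_, fun x hx => ?_, fun x hx => ?_, ?_, key⟩
  · unfold rho
    fun_prop
  · have h := key x x hx hx
    rw [real_inner_self_eq_norm_sq, real_inner_self_eq_norm_sq, hx] at h
    nlinarith [norm_nonneg (dMap ξ x)]
  · exact div_pos (one_sub_norm_sq_pos hξ) (dMap_denom_pos hξ hx)
  · refine ⟨(1 - ‖ξ‖ ^ 2) / (1 - ‖ξ‖) ^ 2, fun x hx => ?_⟩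
    have h := (abs_le.1 (abs_real_inner_le_norm ξ x)).1
    rw [hx, mul_one] at h
    refine div_le_div_of_nonneg_left (one_sub_norm_sq_pos hξ).le (by nlinarith) (by nlinarith)

theorem dMap_neg_dMap {ξ x : Eu n} (hξ : ‖ξ‖ < 1) (hx : ‖x‖ = 1) :
    dMap (-ξ) (dMap ξ x) = x := by
  have h1 := (dMap_denom_pos hξ hx).ne'
  have h2 := (one_sub_norm_sq_pos hξ).ne'
  have hn : ‖dMap ξ x‖ = 1 := (isConf_dMap hξ).norm_eq x hx
  have hden : 1 + 2 * ⟪-ξ, dMap ξ x⟫ + 1 ^ 2 * ‖-ξ‖ ^ 2 =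
      (1 - ‖ξ‖ ^ 2) ^ 2 / (1 + 2 * ⟪ξ, x⟫ + ‖ξ‖ ^ 2) := by
    rw [inner_neg_left, inner_dMap _ _ hx, norm_neg, real_inner_self_eq_norm_sq]
    field_simp
    ring
  have hin : 1 + 2 * ⟪-ξ, dMap ξ x⟫ + 1 ^ 2 = (1 - ‖ξ‖ ^ 2) * (2 + 2 * ⟪ξ, x⟫) /
      (1 + 2 * ⟪ξ, x⟫ + ‖ξ‖ ^ 2) := by
    rw [inner_neg_left, inner_dMap _ _ hx, real_inner_self_eq_norm_sq]
    field_simp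
    ring
  rw [dMap, hn, hden, hin, dMap, hx, norm_neg]
  simp only [smul_add, smul_smul, smul_neg, one_pow, one_mul]
  rw [add_assoc, ← sub_eq_add_neg, ← sub_smul]
  convert add_zero x using 2
  · convert one_smul ℝ x using 2
    field_simp
  · convert zero_smul ℝ ξ using 2
    field_simp
    ring

theorem dMap_dMap_neg {ξ x : Eu n} (hξ : ‖ξ‖ < 1) (hx : ‖x‖ = 1) :
    dMap ξ (dMap (-ξ) x) = x := by
  simpa using dMap_neg_dMap (ξ := -ξ) (by simpa using hξ) hx

theorem dMap_zero {x : Eu n} : dMap 0 x = x := by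
  simp [dMap]

theorem Refl_neg (p : Eu n) : Refl (-p) = Refl p := by
  ext1 x
  simp [Refl]

theorem inner_Refl_Refl {p : Eu n} (hp : ‖p‖ = 1) (x y : Eu n) :
    ⟪Refl p x, Refl p y⟫ = ⟪x, y⟫ := by
  simp only [Refl, inner_sub_left, inner_sub_right, inner_smul_left, inner_smul_right,
    real_inner_self_eq_norm_sq, hp, conj_trivial, real_inner_comm p x]
  ring

theorem norm_Refl {p : Eu n} (hp : ‖p‖ = 1) (x : Eu n) : ‖Refl p x‖ = ‖x‖ := by
  rw [@norm_eq_sqrt_real_inner _ _ _ (Refl p x), inner_Refl_Refl hp, ← norm_eq_sqrt_real_inner]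

theorem inner_self_Refl {p : Eu n} (hp : ‖p‖ = 1) (x : Eu n) : ⟪p, Refl p x⟫ = -⟪p, x⟫ := by
  simp only [Refl, inner_sub_right, inner_smul_right, real_inner_self_eq_norm_sq, hp]
  ring

theorem Refl_Refl {p : Eu n} (hp : ‖p‖ = 1) (x : Eu n) : Refl p (Refl p x) = x := by
  nth_rewrite 1 [Refl]
  rw [inner_self_Refl hp, Refl]
  module

theorem Refl_smul (p : Eu n) (c : ℝ) (x : Eu n) : Refl p (c • x) = c • Refl p x := by
  simp only [Refl, inner_smul_right]
  module

theorem Refl_add (p x y : Eu n) : Refl p (x + y) = Refl p x + Refl p y := by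
  simp only [Refl, inner_add_right]
  module

theorem Refl_dMap {p : Eu n} (hp : ‖p‖ = 1) (ξ x : Eu n) :
    Refl p (dMap ξ x) = dMap (Refl p ξ) (Refl p x) := by
  simp only [dMap, Refl_smul, Refl_add, inner_Refl_Refl hp, norm_Refl hp]

theorem isConf_Refl {p : Eu n} (hp : ‖p‖ = 1) : IsConf (Refl p) fun _ => 1 where
  measurable := by
    unfold Refl
    fun_prop
  measurable_factor := measurable_const
  norm_eq x hx := by rw [norm_Refl hp, hx]
  pos _ _ := one_pos
  bdd := ⟨1, fun _ _ => le_rfl⟩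
  one_sub_inner x y _ _ := by rw [inner_Refl_Refl hp]; ring

theorem norm_smul_lt_one {p : Eu n} (hp : ‖p‖ = 1) {r : ℝ} (hr : r ∈ Ioo (-1 : ℝ) 1) :
    ‖r • p‖ < 1 := by
  rw [norm_smul, hp, mul_one, Real.norm_eq_abs]
  exact abs_lt.2 hr

/-- The conformal factor of `tauMap r p`. -/
def tauRho (r : ℝ) (p x : Eu n) : ℝ :=
  rho (r • p) (Refl p (dMap (-(r • p)) x)) * (1 * rho (-(r • p)) x)

theorem isConf_tauMap {p : Eu n} (hp : ‖p‖ = 1) {r : ℝ} (hr : r ∈ Ioo (-1 : ℝ) 1) :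
    IsConf (tauMap r p) (tauRho r p) :=
  (isConf_dMap (norm_smul_lt_one hp hr)).comp ((isConf_Refl hp).comp
    (isConf_dMap (by rw [norm_neg]; exact norm_smul_lt_one hp hr)))

theorem dMap_neg_tauMap {p : Eu n} (hp : ‖p‖ = 1) {r : ℝ} (hr : r ∈ Ioo (-1 : ℝ) 1) {x : Eu n}
    (hx : ‖x‖ = 1) : dMap (-(r • p)) (tauMap r p x) = Refl p (dMap (-(r • p)) x) := by
  have hξ := norm_smul_lt_one hp hr
  refine dMap_neg_dMap hξ ?_
  rw [Function.comp, norm_Refl hp]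
  exact (isConf_dMap (by rwa [norm_neg])).norm_eq x hx

theorem tauMap_tauMap {p : Eu n} (hp : ‖p‖ = 1) {r : ℝ} (hr : r ∈ Ioo (-1 : ℝ) 1) {x : Eu n}
    (hx : ‖x‖ = 1) : tauMap r p (tauMap r p x) = x := by
  have hξ := norm_smul_lt_one hp hr
  change dMap (r • p) (Refl p (dMap (-(r • p)) (tauMap r p x))) = x
  rw [dMap_neg_tauMap hp hr hx, Refl_Refl hp, dMap_dMap_neg hξ hx]

theorem tauMap_neg_neg (r : ℝ) (p : Eu n) : tauMap (-r) (-p) = tauMap r p := by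
  simp only [tauMap, smul_neg, neg_smul, neg_neg, Refl_neg]

theorem tauMap_zero {p x : Eu n} : tauMap 0 p x = Refl p x := by
  simp [tauMap, dMap_zero]

theorem tauMap_eq_self {p : Eu n} (hp : ‖p‖ = 1) {r : ℝ} (hr : r ∈ Ioo (-1 : ℝ) 1) {x : Eu n}
    (hx : ‖x‖ = 1) (h : ⟪p, dMap (-(r • p)) x⟫ = 0) : tauMap r p x = x := by
  have h1 : Refl p (dMap (-(r • p)) x) = dMap (-(r • p)) x := by
    rw [Refl, h]
    simp
  change dMap (r • p) (Refl p (dMap (-(r • p)) x)) = x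
  rw [h1, dMap_dMap_neg (norm_smul_lt_one hp hr) hx]

theorem mem_cap_iff {p : Eu n} (hp : ‖p‖ = 1) {r : ℝ} (hr : r ∈ Ioo (-1 : ℝ) 1) {x : Eu n} :
    x ∈ cap n r p ↔ ‖x‖ = 1 ∧ 0 < ⟪p, dMap (-(r • p)) x⟫ := by
  have hξ := norm_smul_lt_one hp hr
  simp only [cap, sphSet, mem_image, mem_ofPred_eq, mem_sphere_iff_norm, sub_zero]
  constructor
  · rintro ⟨y, ⟨hy, hpy⟩, rfl⟩
    exact ⟨(isConf_dMap hξ).norm_eq y hy, by rwa [dMap_neg_dMap hξ hy]⟩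
  · rintro ⟨hx, hpx⟩
    exact ⟨_, ⟨(isConf_dMap (by rwa [norm_neg])).norm_eq x hx, hpx⟩, dMap_dMap_neg hξ hx⟩

theorem mem_cap_neg_neg_iff {p : Eu n} (hp : ‖p‖ = 1) {r : ℝ} (hr : r ∈ Ioo (-1 : ℝ) 1)
    {x : Eu n} : x ∈ cap n (-r) (-p) ↔ ‖x‖ = 1 ∧ ⟪p, dMap (-(r • p)) x⟫ < 0 := by
  rw [mem_cap_iff (by rwa [norm_neg]) ⟨by linarith [hr.2], by linarith [hr.1]⟩]
  simp

theorem inner_dMap_neg_smul {p : Eu n} (hp : ‖p‖ = 1) (r : ℝ) {x : Eu n} (hx : ‖x‖ = 1) :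
    ⟪p, dMap (-(r • p)) x⟫ =
      ((1 + r ^ 2) * ⟪p, x⟫ - 2 * r) / (1 - 2 * r * ⟪p, x⟫ + r ^ 2) := by
  rw [inner_dMap _ _ hx]
  simp only [inner_neg_left, inner_neg_right, inner_smul_left, inner_smul_right, norm_neg,
    norm_smul, hp, real_inner_self_eq_norm_sq, conj_trivial, Real.norm_eq_abs, mul_one, sq_abs]
  congr 1 <;> ring

end Moebius

theorem integrable_of_le_on_sphere {n : ℕ} {ν : Measure (Eu n)} [IsFiniteMeasure ν]
    (hsph : ∀ᵐ x ∂ν, ‖x‖ = 1) {f : Eu n → ℝ} (hf : Measurable f) (C : ℝ)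
    (hC : ∀ x, ‖x‖ = 1 → |f x| ≤ C) : Integrable f ν :=
  Integrable.of_bound hf.aestronglyMeasurable C (hsph.mono fun x hx => hC x hx)

/-- A measure without atoms on the sphere is not concentrated on a pair of antipodal points. -/
theorem not_ae_inner_sq_eq {n : ℕ} {ν : Measure (Eu n)} [NullSingletonClass ν] (hν0 : ν ≠ 0)
    (hsph : ∀ᵐ x ∂ν, ‖x‖ = 1) {b : Eu n} (hb : b ≠ 0) : ¬ ∀ᵐ y ∂ν, ⟪b, y⟫ ^ 2 = ‖b‖ ^ 2 := by
  intro hae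
  have hbn : ‖b‖ ≠ 0 := norm_ne_zero_iff.2 hb
  have hpts : ∀ᵐ y ∂ν, y ∈ ({‖b‖⁻¹ • b, -(‖b‖⁻¹ • b)} : Set (Eu n)) := by
    filter_upwards [hsph, hae] with y hy h2
    have hu : ‖‖b‖⁻¹ • b‖ = 1 := by rw [norm_smul, norm_inv, norm_norm, inv_mul_cancel₀ hbn]
    rcases sq_eq_sq_iff_eq_or_eq_neg.1 h2 with h | h
    · left
      refine ((inner_eq_one_iff_of_norm_eq_one (𝕜 := ℝ) hu hy).1 ?_).symm
      rw [inner_smul_left, h]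
      simp [hbn]
    · right
      refine ((inner_eq_one_iff_of_norm_eq_one (𝕜 := ℝ) (by rwa [norm_neg]) hy).1 ?_).symm
      rw [inner_neg_left, inner_smul_left, h]
      simp [hbn]
  have hfin : ν ({‖b‖⁻¹ • b, -(‖b‖⁻¹ • b)} : Set (Eu n)) = 0 :=
    (Set.toFinite _).measure_zero ν
  apply hν0
  rw [← Measure.measure_univ_eq_zero]
  refine measure_mono_null (fun x _ => ?_) (measure_union_null hfin hpts)
  by_cases hx : x ∈ ({‖b‖⁻¹ • b, -(‖b‖⁻¹ • b)} : Set (Eu n))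
  · exact Or.inl hx
  · exact Or.inr hx

/-- A conformal map which renormalizes an already renormalized measure is an isometry. -/
theorem IsConf.factor_eq_one {n : ℕ} {ν : Measure (Eu n)} [IsFiniteMeasure ν] [NullSingletonClass ν]
    (hν0 : ν ≠ 0) (hsph : ∀ᵐ x ∂ν, ‖x‖ = 1) {T : Eu n → Eu n} {ρ : Eu n → ℝ} (hT : IsConf T ρ)
    (h0 : ∀ s, ∫ x, (⟪s, x⟫ : ℝ) ∂ν = 0) (h1 : ∀ s, ‖s‖ = 1 → ∫ x, (⟪s, T x⟫ : ℝ) ∂ν = 0) :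
    ∀ x, ‖x‖ = 1 → ρ x = 1 := by
  obtain ⟨C, hC⟩ := hT.bdd
  have hρi : Integrable ρ ν := integrable_of_le_on_sphere hsph hT.measurable_factor C
    fun x hx => by rw [abs_of_pos (hT.pos x hx)]; exact hC x hx
  have hvi : Integrable (fun y => ρ y • y) ν := by
    refine Integrable.of_bound (hT.measurable_factor.smul measurable_id).aestronglyMeasurable C
      (hsph.mono fun x hx => ?_)
    rw [norm_smul, hx, mul_one, Real.norm_of_nonneg (hT.pos x hx).le]
    exact hC x hx
  have hii : ∀ s, Integrable (fun x : Eu n => (⟪s, x⟫ : ℝ)) ν := fun s =>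
    integrable_of_le_on_sphere hsph (by fun_prop) ‖s‖ fun x hx => by
      simpa [hx] using abs_real_inner_le_norm s x
  have hTi : ∀ s, Integrable (fun x : Eu n => (⟪s, T x⟫ : ℝ)) ν := fun s =>
    integrable_of_le_on_sphere hsph (by have := hT.measurable; fun_prop) ‖s‖ fun x hx => by
      simpa [hT.norm_eq x hx] using abs_real_inner_le_norm s (T x)
  have hρsi : ∀ s, Integrable (fun x : Eu n => ρ x * ⟪s, x⟫) ν := fun s => by
    have := hvi.const_inner (𝕜 := ℝ) s
    simpa [inner_smul_right] using this
  set V := ν.real univ with hV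
  have hVpos : 0 < V := by
    refine ENNReal.toReal_pos ?_ (measure_ne_top _ _)
    simpa using hν0
  set a := (∫ y, ρ y ∂ν) / V with ha
  set b : Eu n := V⁻¹ • ∫ y, ρ y • y ∂ν with hb
  have hA : ∫ y, ρ y ∂ν = a * V := by rw [ha]; field_simp
  have hB : ∀ s, ∫ y, ρ y * ⟪s, y⟫ ∂ν = V * ⟪s, b⟫ := by
    intro s
    have := integral_inner (𝕜 := ℝ) hvi s
    simp only [inner_smul_right] at this
    rw [this, hb, inner_smul_right]
    field_simp
  have haff : ∀ x, ‖x‖ = 1 → ρ x * (a - ⟪x, b⟫) = 1 := by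
    intro x hx
    have e1 : ∫ y, (1 - ⟪T x, T y⟫ : ℝ) ∂ν = V := by
      rw [integral_sub (integrable_const _) (hTi _), h1 _ (hT.norm_eq x hx)]
      simp [hV]
    have e2 : ∫ y, (1 - ⟪T x, T y⟫ : ℝ) ∂ν = ∫ y, (ρ x * (ρ y - ρ y * ⟪x, y⟫)) ∂ν := by
      refine integral_congr_ae (hsph.mono fun y hy => ?_)
      simp only
      rw [hT.one_sub_inner x y hx hy]
      ring
    rw [e1, integral_const_mul, integral_sub hρi (hρsi x), hA, hB] at e2
    have : V * (ρ x * (a - ⟪x, b⟫)) = V * 1 := by linarith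
    exact mul_left_cancel₀ hVpos.ne' this
  have hrel : a ^ 2 - ‖b‖ ^ 2 = 1 := by
    have e1 := hB b
    have e2 : ∫ y, ρ y * ⟪b, y⟫ ∂ν = ∫ y, (a * ρ y - 1) ∂ν := by
      refine integral_congr_ae (hsph.mono fun y hy => ?_)
      have := haff y hy
      simp only
      rw [real_inner_comm]
      linarith
    rw [e2, integral_sub (hρi.const_mul a) (integrable_const _), integral_const_mul, hA,
      real_inner_self_eq_norm_sq] at e1
    simp only [integral_const, smul_eq_mul, mul_one] at e1
    have : V * (a ^ 2 - ‖b‖ ^ 2) = V * 1 := by linarith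
    exact mul_left_cancel₀ hVpos.ne' this
  have hzero : ∫ y, ρ y * (‖b‖ ^ 2 - ⟪b, y⟫ ^ 2) ∂ν = 0 := by
    have e : ∫ y, ρ y * (‖b‖ ^ 2 - ⟪b, y⟫ ^ 2) ∂ν =
        ∫ y, ((‖b‖ ^ 2 - a ^ 2) * ρ y + (a + ⟪b, y⟫)) ∂ν := by
      refine integral_congr_ae (hsph.mono fun y hy => ?_)
      have := haff y hy
      rw [real_inner_comm] at this
      simp only
      linear_combination (a + ⟪b, y⟫) * this
    have hab : Integrable (fun y : Eu n => a + (⟪b, y⟫ : ℝ)) ν := (integrable_const _).add (hii b)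
    rw [e, integral_add (hρi.const_mul _) hab, integral_const_mul,
      integral_add (integrable_const _) (hii b), hA, h0]
    simp only [integral_const, smul_eq_mul]
    linear_combination (-(a * V)) * hrel
  have hb0 : b = 0 := by
    by_contra hbne
    have hnn : 0 ≤ᵐ[ν] fun y => ρ y * (‖b‖ ^ 2 - ⟪b, y⟫ ^ 2) := hsph.mono fun y hy => by
      have h := abs_real_inner_le_norm b y
      rw [hy, mul_one] at h
      refine mul_nonneg (hT.pos y hy).le ?_
      rw [← sq_abs ⟪b, y⟫]
      exact sub_nonneg.2 (pow_le_pow_left₀ (abs_nonneg _) h 2)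
    have hint : Integrable (fun y => ρ y * (‖b‖ ^ 2 - ⟪b, y⟫ ^ 2)) ν := by
      refine integrable_of_le_on_sphere hsph
        (hT.measurable_factor.mul (by fun_prop)) (C * ‖b‖ ^ 2) fun y hy => ?_
      have h := abs_real_inner_le_norm b y
      rw [hy, mul_one] at h
      have h2 : ⟪b, y⟫ ^ 2 ≤ ‖b‖ ^ 2 := by
        rw [← sq_abs ⟪b, y⟫]
        exact pow_le_pow_left₀ (abs_nonneg _) h 2
      rw [abs_of_nonneg (mul_nonneg (hT.pos y hy).le (sub_nonneg.2 h2))]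
      exact mul_le_mul (hC y hy) (by nlinarith [sq_nonneg (⟪b, y⟫ : ℝ)]) (sub_nonneg.2 h2)
        ((hT.pos y hy).le.trans (hC y hy))
    have hae := (integral_eq_zero_iff_of_nonneg_ae hnn hint).1 hzero
    refine not_ae_inner_sq_eq hν0 hsph hbne ?_
    filter_upwards [hsph, hae] with y hy hy0
    have := (mul_eq_zero.1 hy0).resolve_left (hT.pos y hy).ne'
    linarith
  intro x hx
  have h := haff x hx
  rw [hb0, inner_zero_right, sub_zero] at h
  rw [hb0, norm_zero] at hrel
  have hapos : 0 < a := by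
    by_contra! hle
    nlinarith [hT.pos x hx]
  have ha1 : a = 1 := by nlinarith
  rwa [ha1, mul_one] at h

section CapMeasures

variable {n : ℕ}

theorem span_singleton_ne_top (hn : 1 ≤ n) (x : Eu n) : Submodule.span ℝ {x} ≠ ⊤ := by
  intro h
  have h1 := finrank_span_le_card (R := ℝ) ({x} : Set (Eu n))
  rw [h, finrank_top, finrank_euclideanSpace_fin] at h1
  simp at h1
  omega

theorem sphMeasure_singleton (hn : 1 ≤ n) (x : Eu n) : sphMeasure n {x} = 0 := by
  rw [sphMeasure, (MeasurableEmbedding.subtype_coe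
    Metric.isClosed_sphere.measurableSet).map_apply, Measure.toSphere_apply' _
    (measurable_subtype_coe (measurableSet_singleton x))]
  refine mul_eq_zero_of_right _ (measure_mono_null ?_
    (Measure.addHaar_submodule volume (Submodule.span ℝ {x}) ?_))
  · rintro _ ⟨c, -, _, ⟨y, hy, rfl⟩, rfl⟩
    rw [mem_preimage, mem_singleton_iff] at hy
    exact Submodule.mem_span_singleton.2 ⟨c, by simp [hy]⟩
  · exact span_singleton_ne_top hn x

theorem nullSingletonClass_confMeasure (hn : 1 ≤ n) (w : Eu n → ℝ) :
    NullSingletonClass (confMeasure n w) :=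
  ⟨fun x => withDensity_absolutelyContinuous _ _ (sphMeasure_singleton hn x)⟩

theorem ae_norm_eq_one_confMeasure (w : Eu n → ℝ) : ∀ᵐ x ∂confMeasure n w, ‖x‖ = 1 := by
  suffices h : ∀ᵐ x ∂sphMeasure n, ‖x‖ = 1 from (withDensity_absolutelyContinuous _ _).ae_le h
  rw [sphMeasure, ae_map_iff measurable_subtype_coe.aemeasurable
    (measurableSet_eq_fun measurable_norm measurable_const)]
  exact Filter.Eventually.of_forall fun x => norm_eq_of_mem_sphere x

theorem IsConf.injOn {T : Eu n → Eu n} {ρ : Eu n → ℝ} (hT : IsConf T ρ) {x y : Eu n}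
    (hx : ‖x‖ = 1) (hy : ‖y‖ = 1) (h : T x = T y) : x = y := by
  have h1 := hT.one_sub_inner x y hx hy
  rw [h, real_inner_self_eq_norm_sq, hT.norm_eq y hy] at h1
  have h2 : 1 - ⟪x, y⟫ = (0 : ℝ) :=
    (mul_eq_zero.1 (by linarith : ρ x * ρ y * (1 - ⟪x, y⟫) = 0)).resolve_left
      (mul_pos (hT.pos x hx) (hT.pos y hy)).ne'
  exact (inner_eq_one_iff_of_norm_eq_one (𝕜 := ℝ) hx hy).1 (by linarith)

theorem IsConf.ae_map {T : Eu n → Eu n} {ρ : Eu n → ℝ} (hT : IsConf T ρ)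
    {ν : Measure (Eu n)} (hsph : ∀ᵐ x ∂ν, ‖x‖ = 1) : ∀ᵐ x ∂ν.map T, ‖x‖ = 1 := by
  rw [ae_map_iff hT.measurable.aemeasurable (measurableSet_eq_fun measurable_norm measurable_const)]
  exact hsph.mono hT.norm_eq

theorem IsConf.nullSingletonClass_map {T : Eu n → Eu n} {ρ : Eu n → ℝ} (hT : IsConf T ρ)
    {ν : Measure (Eu n)} [NullSingletonClass ν] (hsph : ∀ᵐ x ∂ν, ‖x‖ = 1) :
    NullSingletonClass (ν.map T) := by
  refine ⟨fun z => ?_⟩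
  rw [Measure.map_apply hT.measurable (measurableSet_singleton z)]
  have hsub : ({x | x ∈ T ⁻¹' {z} ∧ ‖x‖ = 1} : Set (Eu n)).Subsingleton := fun x hx y hy =>
    hT.injOn hx.2 hy.2 (hx.1.trans hy.1.symm)
  refine measure_mono_null (fun x hx => ?_)
    (measure_union_null (hsub.measure_zero ν) hsph)
  by_cases h : ‖x‖ = 1
  · exact Or.inl ⟨hx, h⟩
  · exact Or.inr h

theorem ae_norm_eq_one_capMeasure (w : Eu n → ℝ) {p : Eu n} (hp : ‖p‖ = 1) {r : ℝ}
    (hr : r ∈ Ioo (-1 : ℝ) 1) : ∀ᵐ x ∂capMeasure n w r p, ‖x‖ = 1 := by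
  refine ae_restrict_of_ae (ae_add_measure_iff.2 ⟨ae_norm_eq_one_confMeasure w, ?_⟩)
  exact (isConf_tauMap hp hr).ae_map (ae_norm_eq_one_confMeasure w)

theorem nullSingletonClass_capMeasure (hn : 1 ≤ n) (w : Eu n → ℝ) {p : Eu n} (hp : ‖p‖ = 1)
    {r : ℝ} (hr : r ∈ Ioo (-1 : ℝ) 1) : NullSingletonClass (capMeasure n w r p) := by
  have h1 := nullSingletonClass_confMeasure hn w
  have h2 := (isConf_tauMap hp hr).nullSingletonClass_map (ae_norm_eq_one_confMeasure w)
  refine ⟨fun x => ?_⟩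
  have : (confMeasure n w + Measure.map (tauMap r p) (confMeasure n w)) {x} = 0 := by
    simp
  exact Measure.absolutelyContinuous_of_le Measure.restrict_le_self this

theorem isFiniteMeasure_capMeasure (w : Eu n → ℝ) [IsFiniteMeasure (confMeasure n w)] (r : ℝ)
    (p : Eu n) : IsFiniteMeasure (capMeasure n w r p) := by
  unfold capMeasure
  infer_instance

theorem measurableSet_cap {p : Eu n} (hp : ‖p‖ = 1) {r : ℝ} (hr : r ∈ Ioo (-1 : ℝ) 1) :
    MeasurableSet (cap n r p) := by
  have : cap n r p = {x | ‖x‖ = 1} ∩ {x | 0 < ⟪p, dMap (-(r • p)) x⟫} := by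
    ext x
    exact mem_cap_iff hp hr
  rw [this]
  refine (measurableSet_eq_fun measurable_norm measurable_const).inter
    (measurableSet_lt measurable_const ?_)
  exact measurable_const.inner (measurable_dMap _)

theorem map_tauMap_map_tauMap {p : Eu n} (hp : ‖p‖ = 1) {r : ℝ} (hr : r ∈ Ioo (-1 : ℝ) 1)
    {ν : Measure (Eu n)} (hsph : ∀ᵐ x ∂ν, ‖x‖ = 1) :
    (ν.map (tauMap r p)).map (tauMap r p) = ν := by
  have hm := (isConf_tauMap hp hr).measurable
  rw [Measure.map_map hm hm]
  refine (Measure.map_congr ?_).trans Measure.map_id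
  exact hsph.mono fun x hx => tauMap_tauMap hp hr hx

theorem capMeasure_neg_neg (w : Eu n → ℝ) {p : Eu n} (hp : ‖p‖ = 1) {r : ℝ}
    (hr : r ∈ Ioo (-1 : ℝ) 1) :
    capMeasure n w (-r) (-p) = (capMeasure n w r p).map (tauMap r p) := by
  have hm := (isConf_tauMap hp hr).measurable
  have hp' : ‖-p‖ = 1 := by rwa [norm_neg]
  have hr' : -r ∈ Ioo (-1 : ℝ) 1 := ⟨by linarith [hr.2], by linarith [hr.1]⟩
  have hσ := ae_norm_eq_one_confMeasure w
  have hinv : (confMeasure n w + Measure.map (tauMap r p) (confMeasure n w)).map (tauMap r p) =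
      confMeasure n w + Measure.map (tauMap r p) (confMeasure n w) := by
    rw [Measure.map_add _ _ hm, map_tauMap_map_tauMap hp hr hσ,
      add_comm (Measure.map _ _)]
  have hsph : ∀ᵐ x ∂(confMeasure n w + Measure.map (tauMap r p) (confMeasure n w)), ‖x‖ = 1 :=
    ae_add_measure_iff.2 ⟨hσ, (isConf_tauMap hp hr).ae_map hσ⟩
  rw [capMeasure, tauMap_neg_neg, ← hinv, Measure.restrict_map hm (measurableSet_cap hp' hr'),
    capMeasure]
  congr 1
  refine Measure.restrict_congr_set ?_
  filter_upwards [hsph] with x hx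
  refine propext ?_
  change tauMap r p x ∈ cap n (-r) (-p) ↔ x ∈ cap n r p
  rw [mem_cap_neg_neg_iff hp hr, mem_cap_iff hp hr, dMap_neg_tauMap hp hr hx, inner_self_Refl hp]
  simp [hx, (isConf_tauMap hp hr).norm_eq x hx]

end CapMeasures

section MaximalDirections

variable {n : ℕ} {ν : Measure (Eu n)}

theorem Qform_smul (c : ℝ) (s : Eu n) : Qform ν (c • s) = c ^ 2 * Qform ν s := by
  simp only [Qform, inner_smul_left, conj_trivial, mul_pow, integral_const_mul]

theorem inner_sq_le (s : Eu n) {x : Eu n} (hx : ‖x‖ = 1) : ⟪s, x⟫ ^ 2 ≤ ‖s‖ ^ 2 := by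
  have h := abs_real_inner_le_norm s x
  rw [hx, mul_one] at h
  rw [← sq_abs ⟪s, x⟫]
  exact pow_le_pow_left₀ (abs_nonneg _) h 2

theorem integrable_inner_sq [IsFiniteMeasure ν] (hsph : ∀ᵐ x ∂ν, ‖x‖ = 1) (s : Eu n) :
    Integrable (fun x : Eu n => (⟪s, x⟫ : ℝ) ^ 2) ν :=
  integrable_of_le_on_sphere hsph (by fun_prop) (‖s‖ ^ 2) fun x hx => by
    rw [abs_of_nonneg (sq_nonneg _)]
    exact inner_sq_le s hx

theorem Qform_le_norm_sq_mul [IsFiniteMeasure ν] (hsph : ∀ᵐ x ∂ν, ‖x‖ = 1) (s : Eu n) :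
    Qform ν s ≤ ‖s‖ ^ 2 * ν.real univ := by
  have := integral_mono_ae (integrable_inner_sq hsph s) (integrable_const (‖s‖ ^ 2))
    (hsph.mono fun x hx => inner_sq_le s hx)
  simpa [mul_comm, Qform] using this

theorem Qform_le_maxEig_of_norm_eq_one [IsFiniteMeasure ν] (hsph : ∀ᵐ x ∂ν, ‖x‖ = 1) {s : Eu n}
    (hs : ‖s‖ = 1) : Qform ν s ≤ maxEig n ν := by
  refine le_csSup ⟨ν.real univ, ?_⟩ ⟨s, hs, rfl⟩
  rintro _ ⟨t, ht, rfl⟩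
  simpa [ht] using Qform_le_norm_sq_mul hsph t

theorem Qform_le_maxEig [IsFiniteMeasure ν] (hsph : ∀ᵐ x ∂ν, ‖x‖ = 1) (s : Eu n) :
    Qform ν s ≤ maxEig n ν * ‖s‖ ^ 2 := by
  rcases eq_or_ne s 0 with rfl | hs
  · simp [Qform]
  have hs' : ‖s‖ ≠ 0 := norm_ne_zero_iff.2 hs
  have h := Qform_le_maxEig_of_norm_eq_one hsph (s := ‖s‖⁻¹ • s)
    (by rw [norm_smul, norm_inv, norm_norm, inv_mul_cancel₀ hs'])
  rw [Qform_smul, inv_pow, inv_mul_eq_div, div_le_iff₀ (by positivity)] at h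
  exact h

theorem Qform_lt [IsFiniteMeasure ν] [NullSingletonClass ν] (hν0 : ν ≠ 0)
    (hsph : ∀ᵐ x ∂ν, ‖x‖ = 1) {s : Eu n} (hs : ‖s‖ = 1) : Qform ν s < ν.real univ := by
  refine lt_of_le_of_ne (by simpa [hs] using Qform_le_norm_sq_mul hsph s) fun h => ?_
  refine not_ae_inner_sq_eq hν0 hsph (b := s) (by rw [← norm_ne_zero_iff, hs]; exact one_ne_zero) ?_
  have hnn : 0 ≤ᵐ[ν] fun x => ‖s‖ ^ 2 - ⟪s, x⟫ ^ 2 :=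
    hsph.mono fun x hx => sub_nonneg.2 (inner_sq_le s hx)
  have hint := (integrable_const (μ := ν) (‖s‖ ^ 2)).sub (integrable_inner_sq hsph s)
  have h0 : ∫ x, (‖s‖ ^ 2 - ⟪s, x⟫ ^ 2 : ℝ) ∂ν = 0 := by
    rw [integral_sub (integrable_const _) (integrable_inner_sq hsph s)]
    change _ - Qform ν s = 0
    rw [h, hs]
    simp
  filter_upwards [(integral_eq_zero_iff_of_nonneg_ae hnn hint).1 h0] with x hx
  have : ‖s‖ ^ 2 - ⟪s, x⟫ ^ 2 = 0 := hx
  linarith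

theorem IsMaxDir.Qform_eq {s₀ : Eu n} (h : IsMaxDir ν s₀) : Qform ν s₀ = maxEig n ν := by
  simpa [h.1] using (h.2 s₀).2 ⟨1, (one_smul _ _).symm⟩

theorem IsMaxDir.eq_or_eq_neg {s₀ s : Eu n} (h : IsMaxDir ν s₀) (hs : ‖s‖ = 1)
    (hQ : Qform ν s = maxEig n ν) : s = s₀ ∨ s = -s₀ := by
  obtain ⟨c, rfl⟩ := (h.2 s).1 (by rw [hQ, hs]; ring)
  rw [norm_smul, h.1, mul_one, Real.norm_eq_abs] at hs
  rcases (abs_eq zero_le_one).1 hs with rfl | rfl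
  · exact Or.inl (one_smul _ _)
  · exact Or.inr (neg_one_smul _ _)

theorem IsMaxDir.measure_ne_zero (hn : 1 ≤ n) {s₀ : Eu n} (h : IsMaxDir ν s₀) : ν ≠ 0 := by
  rintro rfl
  refine span_singleton_ne_top hn s₀ (eq_top_iff.2 fun s _ => ?_)
  have hQ : ∀ t : Eu n, Qform (0 : Measure (Eu n)) t = 0 := fun t => by simp [Qform]
  obtain ⟨c, rfl⟩ := (h.2 s).1 (by rw [← h.Qform_eq, hQ, hQ, zero_mul])
  exact Submodule.mem_span_singleton.2 ⟨c, rfl⟩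

theorem Renormalizes.integral_inner_eq_zero {ξ : Eu n} (h : Renormalizes ξ ν) (s : Eu n) :
    ∫ x, (⟪s, dMap ξ x⟫ : ℝ) ∂ν = 0 := by
  rcases eq_or_ne s 0 with rfl | hs
  · simp
  have hs' : ‖s‖ ≠ 0 := norm_ne_zero_iff.2 hs
  have h1 := h (‖s‖⁻¹ • s) (by
    rw [sphSet, mem_sphere_iff_norm, sub_zero, norm_smul, norm_inv, norm_norm,
      inv_mul_cancel₀ hs'])
  simp only [Xfun, inner_smul_left, conj_trivial, integral_const_mul] at h1
  exact (mul_eq_zero.1 h1).resolve_left (inv_ne_zero hs')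

theorem inner_self_dMap_ge {ξ x : Eu n} (hξ : ‖ξ‖ < 1) (hx : ‖x‖ = 1) :
    ⟪ξ, x⟫ + (‖ξ‖ ^ 2 - ⟪ξ, x⟫ ^ 2) / 2 ≤ ⟪ξ, dMap ξ x⟫ := by
  have hD := dMap_denom_pos hξ hx
  have hsq := inner_sq_le ξ hx
  have hu := (abs_le.1 (abs_real_inner_le_norm ξ x)).2
  rw [hx, mul_one] at hu
  rw [inner_dMap _ _ hx, le_div_iff₀ hD, real_inner_self_eq_norm_sq]
  nlinarith [mul_nonneg (sub_nonneg.2 hsq)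
    (by nlinarith [norm_nonneg ξ] : 0 ≤ 4 - (1 + 2 * ⟪ξ, x⟫ + ‖ξ‖ ^ 2))]

theorem abs_setIntegral_le_of_le_on_sphere [IsFiniteMeasure ν] (hsph : ∀ᵐ x ∂ν, ‖x‖ = 1)
    {f : Eu n → ℝ} {C : ℝ} (hC : ∀ x, ‖x‖ = 1 → |f x| ≤ C) :
    |∫ x, f x ∂ν| ≤ C * ν.real univ :=
  norm_integral_le_of_norm_le_const (f := f) (hsph.mono fun x hx => hC x hx)

theorem norm_mul_le_of_renormalizes {σ κ : Measure (Eu n)} [IsProbabilityMeasure σ]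
    [IsFiniteMeasure κ] (hσ : ∀ᵐ x ∂σ, ‖x‖ = 1) (hκ : ∀ᵐ x ∂κ, ‖x‖ = 1) {A : Set (Eu n)}
    (hAm : MeasurableSet A) {δ : ℝ} (hA : σ.real Aᶜ ≤ δ) (hκδ : κ.real univ ≤ δ)
    (h0 : ∀ s, ∫ x, (⟪s, x⟫ : ℝ) ∂σ = 0) {ξ : Eu n} (hξ : ‖ξ‖ < 1)
    (hren : Renormalizes ξ (σ.restrict A + κ)) :
    ‖ξ‖ * (1 - maxEig n σ - δ) ≤ 4 * δ := by
  rcases eq_or_ne ξ 0 with rfl | hne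
  · rw [norm_zero, zero_mul]
    linarith [measureReal_nonneg (μ := σ) (s := Aᶜ)]
  have hpos : 0 < ‖ξ‖ := norm_pos_iff.2 hne
  have hsph : ∀ᵐ x ∂(σ.restrict A + κ), ‖x‖ = 1 :=
    ae_add_measure_iff.2 ⟨ae_restrict_of_ae hσ, hκ⟩
  have hfm : Measurable fun x : Eu n => (⟪ξ, x⟫ : ℝ) + (‖ξ‖ ^ 2 - ⟪ξ, x⟫ ^ 2) / 2 := by fun_prop
  obtain ⟨f, hf⟩ : ∃ f : Eu n → ℝ, f = fun x => (⟪ξ, x⟫ : ℝ) + (‖ξ‖ ^ 2 - ⟪ξ, x⟫ ^ 2) / 2 :=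
    ⟨_, rfl⟩
  rw [← hf] at hfm
  have hbd : ∀ x, ‖x‖ = 1 → |f x| ≤ ‖ξ‖ + ‖ξ‖ ^ 2 / 2 := by
    intro x hx
    have h1 := abs_le.1 (abs_real_inner_le_norm ξ x)
    rw [hx, mul_one] at h1
    have h2 := inner_sq_le ξ hx
    rw [hf, abs_le]
    constructor <;> simp only <;> nlinarith [sq_nonneg (⟪ξ, x⟫ : ℝ)]
  have hlow : ∀ x, ‖x‖ = 1 → -‖ξ‖ ≤ f x := by
    intro x hx
    have h1 := abs_le.1 (abs_real_inner_le_norm ξ x)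
    rw [hx, mul_one] at h1
    have h2 := inner_sq_le ξ hx
    rw [hf]
    simp only
    linarith
  have hfσ : Integrable f σ := integrable_of_le_on_sphere hσ hfm _ hbd
  have hfκ : Integrable f κ := integrable_of_le_on_sphere hκ hfm _ hbd
  have hle : ∫ x, f x ∂(σ.restrict A + κ) ≤ 0 := by
    rw [← hren.integral_inner_eq_zero ξ]
    refine integral_mono_ae (hfσ.restrict.add_measure hfκ) ?_ ?_
    · refine integrable_of_le_on_sphere hsph
        (measurable_const.inner (measurable_dMap ξ)) ‖ξ‖ fun x hx => ?_
      simpa [(isConf_dMap hξ).norm_eq x hx] using abs_real_inner_le_norm ξ (dMap ξ x)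
    · refine hsph.mono fun x hx => ?_
      rw [hf]
      exact inner_self_dMap_ge hξ hx
  rw [integral_add_measure hfσ.restrict hfκ] at hle
  have hsplit := integral_add_compl hAm hfσ
  have hcompl := (abs_le.1 (abs_setIntegral_le_of_le_on_sphere (ν := σ.restrict Aᶜ)
    (ae_restrict_of_ae hσ) hbd)).2
  have hκ' : -‖ξ‖ * κ.real univ ≤ ∫ x, f x ∂κ := by
    have := integral_mono_ae (integrable_const (-‖ξ‖)) hfκ (hκ.mono hlow)
    simpa [mul_comm] using this
  have hσ' : ∫ x, f x ∂σ = (‖ξ‖ ^ 2 - Qform σ ξ) / 2 := by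
    have hi : Integrable (fun x : Eu n => (⟪ξ, x⟫ : ℝ)) σ :=
      integrable_of_le_on_sphere hσ (by fun_prop) ‖ξ‖ fun x hx => by
        simpa [hx] using abs_real_inner_le_norm ξ x
    have hq : Integrable (fun x : Eu n => ‖ξ‖ ^ 2 - (⟪ξ, x⟫ : ℝ) ^ 2) σ :=
      (integrable_const _).sub (integrable_inner_sq hσ ξ)
    rw [hf, integral_add hi (hq.div_const 2), h0, integral_div,
      integral_sub (integrable_const _) (integrable_inner_sq hσ ξ), Qform]
    simp
  have hQ := Qform_le_maxEig hσ ξ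
  rw [measureReal_restrict_apply_univ] at hcompl
  have h3 : (‖ξ‖ + ‖ξ‖ ^ 2 / 2) * σ.real Aᶜ ≤ (‖ξ‖ + ‖ξ‖ ^ 2 / 2) * δ :=
    mul_le_mul_of_nonneg_left hA (by positivity)
  have h4 : ‖ξ‖ * κ.real univ ≤ ‖ξ‖ * δ := mul_le_mul_of_nonneg_left hκδ hpos.le
  refine le_of_mul_le_mul_left ?_ hpos
  nlinarith

end MaximalDirections

section Renormalization

variable {n : ℕ}

/-- Renormalization points `ξ r p` of the cap measures of a normalized conformal measure,
together with a continuous choice `s r p` of their maximal directions. -/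
structure IsCapFamily (n : ℕ) (w : Eu n → ℝ) (ξ s : ℝ → Eu n → Eu n) : Prop where
  one_le : 1 ≤ n
  prob : IsProbabilityMeasure (confMeasure n w)
  mean : ∀ t : Eu n, ∫ x, (⟪t, x⟫ : ℝ) ∂(confMeasure n w) = 0
  isMaxDir_e1 : IsMaxDir (confMeasure n w) (e1 n)
  norm_lt : ∀ {r : ℝ}, r ∈ Ioo (-1 : ℝ) 1 → ∀ {p : Eu n}, ‖p‖ = 1 → ‖ξ r p‖ < 1
  renorm : ∀ {r : ℝ}, r ∈ Ioo (-1 : ℝ) 1 → ∀ {p : Eu n}, ‖p‖ = 1 →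
    Renormalizes (ξ r p) (capMeasure n w r p)
  continuousOn_point : ContinuousOn (fun q : ℝ × Eu n => ξ q.1 q.2) (Ioo (-1 : ℝ) 1 ×ˢ sphSet n)
  isMaxDir : ∀ {r : ℝ}, r ∈ Ioo (-1 : ℝ) 1 → ∀ {p : Eu n}, ‖p‖ = 1 →
    IsMaxDir (Measure.map (dMap (ξ r p)) (capMeasure n w r p)) (s r p)
  continuousOn_dir : ContinuousOn (fun q : ℝ × Eu n => s q.1 q.2) (Ico (-1 : ℝ) 1 ×ˢ sphSet n)
  dir_neg_one : ∀ {p : Eu n}, ‖p‖ = 1 → s (-1) p = -(e1 n)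

theorem eventually_inner_dMap_pos {p x : Eu n} (hp : ‖p‖ = 1) (hx : ‖x‖ = 1) (hxp : x ≠ -p) :
    ∀ᶠ r in 𝓝[Ioo (-1 : ℝ) 1] (-1), 0 < ⟪p, dMap (-(r • p)) x⟫ := by
  have hlt : -1 < (⟪p, x⟫ : ℝ) := by
    have h := (abs_le.1 (abs_real_inner_le_norm p x)).1
    rw [hp, hx, mul_one] at h
    refine lt_of_le_of_ne h fun he => hxp ?_
    refine ((inner_eq_one_iff_of_norm_eq_one (𝕜 := ℝ) (x := -p) (y := x) (by rwa [norm_neg])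
      hx).1 ?_).symm
    rw [inner_neg_left, ← he, neg_neg]
  have hc : Tendsto (fun r : ℝ => (1 + r ^ 2) * (⟪p, x⟫ : ℝ) - 2 * r) (𝓝[Ioo (-1 : ℝ) 1] (-1))
      (𝓝 ((1 + (-1) ^ 2) * ⟪p, x⟫ - 2 * (-1))) :=
    Continuous.tendsto (by fun_prop) _ |>.mono_left nhdsWithin_le_nhds
  filter_upwards [hc.eventually (lt_mem_nhds (by linarith : (0 : ℝ) < _)), self_mem_nhdsWithin]
    with r hr hr1
  rw [inner_dMap_neg_smul hp r hx]
  refine div_pos hr ?_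
  have := dMap_denom_pos (ξ := -(r • p)) (by rw [norm_neg]; exact norm_smul_lt_one hp hr1) hx
  rw [inner_neg_left, inner_smul_left, norm_neg, norm_smul, hp, mul_one, Real.norm_eq_abs,
    sq_abs, conj_trivial] at this
  linarith

theorem tendsto_measureReal_compl_cap (hn : 1 ≤ n) (w : Eu n → ℝ)
    [IsFiniteMeasure (confMeasure n w)] {p : Eu n} (hp : ‖p‖ = 1) :
    Tendsto (fun r => (confMeasure n w).real (cap n r p)ᶜ) (𝓝[Ioo (-1 : ℝ) 1] (-1)) (𝓝 0) := by
  have := nullSingletonClass_confMeasure hn w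
  have h : Tendsto (fun r => ∫ x, (cap n r p)ᶜ.indicator (fun _ => (1 : ℝ)) x ∂confMeasure n w)
      (𝓝[Ioo (-1 : ℝ) 1] (-1)) (𝓝 (∫ _, (0 : ℝ) ∂confMeasure n w)) := by
    refine tendsto_integral_filter_of_dominated_convergence (fun _ => 1) ?_ ?_
      (integrable_const _) ?_
    · filter_upwards [self_mem_nhdsWithin] with r hr
      exact (measurable_const.indicator (measurableSet_cap hp hr).compl).aestronglyMeasurable
    · refine Eventually.of_forall fun r => Eventually.of_forall fun x => ?_
      rw [Real.norm_eq_abs, indicator_apply]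
      split_ifs <;> simp
    · filter_upwards [ae_norm_eq_one_confMeasure w,
        (measure_eq_zero_iff_ae_notMem.1 (measure_singleton (μ := confMeasure n w) (-p)))]
        with x hx hxp
      refine tendsto_const_nhds.congr' ?_
      filter_upwards [eventually_inner_dMap_pos hp hx hxp, self_mem_nhdsWithin] with r hr hr1
      rw [indicator_of_notMem]
      exact fun h => h ((mem_cap_iff hp hr1).2 ⟨hx, hr⟩)
  rw [integral_zero] at h
  refine h.congr' ?_
  filter_upwards [self_mem_nhdsWithin] with r hr
  rw [integral_indicator_const _ (measurableSet_cap hp hr).compl, smul_eq_mul, mul_one]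

theorem IsCapFamily.norm_mul_le {w : Eu n → ℝ} {ξ s : ℝ → Eu n → Eu n}
    (h : IsCapFamily n w ξ s) {r : ℝ} (hr : r ∈ Ioo (-1 : ℝ) 1) {p : Eu n} (hp : ‖p‖ = 1) :
    ‖ξ r p‖ * (1 - maxEig n (confMeasure n w) - (confMeasure n w).real (cap n r p)ᶜ) ≤
      4 * (confMeasure n w).real (cap n r p)ᶜ := by
  have := h.prob
  have hσ := ae_norm_eq_one_confMeasure w
  have hT := isConf_tauMap hp hr
  have hκ := hT.ae_map hσ
  have hren := h.renorm hr hp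
  rw [capMeasure, Measure.restrict_add] at hren
  refine norm_mul_le_of_renormalizes hσ (ae_restrict_of_ae hκ) (measurableSet_cap hp hr) le_rfl ?_
    h.mean (h.norm_lt hr hp) hren
  rw [measureReal_restrict_apply_univ,
    map_measureReal_apply hT.measurable (measurableSet_cap hp hr)]
  refine ENNReal.toReal_mono (measure_ne_top _ _) (measure_mono_ae ?_)
  filter_upwards [hσ] with x hx hxc
  intro hxc'
  have h1 := ((mem_cap_iff hp hr).1 hxc).2
  rw [dMap_neg_tauMap hp hr hx, inner_self_Refl hp] at h1
  linarith [((mem_cap_iff hp hr).1 hxc').2]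

theorem IsCapFamily.tendsto_point {w : Eu n → ℝ} {ξ s : ℝ → Eu n → Eu n}
    (h : IsCapFamily n w ξ s) {p : Eu n} (hp : ‖p‖ = 1) :
    Tendsto (fun r => ξ r p) (𝓝[Ioo (-1 : ℝ) 1] (-1)) (𝓝 0) := by
  have := h.prob
  have := nullSingletonClass_confMeasure h.one_le w
  have hδ := tendsto_measureReal_compl_cap h.one_le w hp
  have hM : maxEig n (confMeasure n w) < 1 := by
    have := Qform_lt (IsProbabilityMeasure.ne_zero (confMeasure n w))
      (ae_norm_eq_one_confMeasure w) h.isMaxDir_e1.1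
    rwa [h.isMaxDir_e1.Qform_eq, probReal_univ] at this
  have hden := (tendsto_const_nhds (x := 1 - maxEig n (confMeasure n w))).sub hδ
  rw [sub_zero] at hden
  have hquot := (hδ.const_mul 4).div hden (by linarith)
  rw [mul_zero, zero_div] at hquot
  refine squeeze_zero_norm' ?_ hquot
  filter_upwards [self_mem_nhdsWithin, hden.eventually (lt_mem_nhds (sub_pos.2 hM))] with r hr hr1
  rw [Pi.div_apply, le_div_iff₀ hr1]
  exact h.norm_mul_le hr hp

end Renormalization

section Transition

variable {n : ℕ}

/-- The conformal map `d_ξ ∘ τ_{r,p} ∘ d_{-ξ'}`. -/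
def transMap (ξ ξ' : Eu n) (r : ℝ) (p : Eu n) : Eu n → Eu n :=
  dMap ξ ∘ tauMap r p ∘ dMap (-ξ')

/-- The conformal factor of `transMap ξ ξ' r p`. -/
def transRho (ξ ξ' : Eu n) (r : ℝ) (p x : Eu n) : ℝ :=
  rho ξ (tauMap r p (dMap (-ξ') x)) * (tauRho r p (dMap (-ξ') x) * rho (-ξ') x)

theorem isConf_transMap {ξ ξ' : Eu n} (hξ : ‖ξ‖ < 1) (hξ' : ‖ξ'‖ < 1) {r : ℝ}
    (hr : r ∈ Ioo (-1 : ℝ) 1) {p : Eu n} (hp : ‖p‖ = 1) :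
    IsConf (transMap ξ ξ' r p) (transRho ξ ξ' r p) :=
  (isConf_dMap hξ).comp ((isConf_tauMap hp hr).comp (isConf_dMap (by rwa [norm_neg])))

theorem transMap_dMap (ξ : Eu n) {ξ' : Eu n} (hξ' : ‖ξ'‖ < 1) (r : ℝ) (p : Eu n) {x : Eu n}
    (hx : ‖x‖ = 1) : transMap ξ ξ' r p (dMap ξ' x) = dMap ξ (tauMap r p x) := by
  rw [transMap, Function.comp, Function.comp, dMap_neg_dMap hξ' hx]

theorem neg_mem_Ioo {r : ℝ} (hr : r ∈ Ioo (-1 : ℝ) 1) : -r ∈ Ioo (-1 : ℝ) 1 :=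
  ⟨by linarith [hr.2], by linarith [hr.1]⟩

namespace IsCapFamily

variable {w : Eu n → ℝ} {ξ s : ℝ → Eu n → Eu n} {r : ℝ} {p : Eu n}

/-- The renormalized measure of the cap `a_{r,p}`. -/
abbrev renormMeasure (w : Eu n → ℝ) (ξ : ℝ → Eu n → Eu n) (r : ℝ) (p : Eu n) : Measure (Eu n) :=
  (capMeasure n w r p).map (dMap (ξ r p))

theorem map_renormMeasure (h : IsCapFamily n w ξ s) (hr : r ∈ Ioo (-1 : ℝ) 1) (hp : ‖p‖ = 1) :
    (renormMeasure w ξ (-r) (-p)).map (transMap (ξ r p) (ξ (-r) (-p)) r p) =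
      renormMeasure w ξ r p := by
  have hr' := neg_mem_Ioo hr
  have hp' : ‖-p‖ = 1 := by rwa [norm_neg]
  have hT := isConf_transMap (h.norm_lt hr hp) (h.norm_lt hr' hp') hr hp
  have hm := (isConf_tauMap hp hr).measurable
  have hsph := ae_norm_eq_one_capMeasure w hp hr
  rw [Measure.map_map hT.measurable (measurable_dMap _), capMeasure_neg_neg w hp hr,
    Measure.map_map (hT.measurable.comp (measurable_dMap _)) hm]
  refine Measure.map_congr (hsph.mono fun x hx => ?_)
  simp only [Function.comp]
  rw [transMap_dMap _ (h.norm_lt hr' hp') _ _ ((isConf_tauMap hp hr).norm_eq x hx),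
    tauMap_tauMap hp hr hx]

theorem ae_norm_eq_one (h : IsCapFamily n w ξ s) (hr : r ∈ Ioo (-1 : ℝ) 1) (hp : ‖p‖ = 1) :
    ∀ᵐ x ∂renormMeasure w ξ r p, ‖x‖ = 1 :=
  (isConf_dMap (h.norm_lt hr hp)).ae_map (ae_norm_eq_one_capMeasure w hp hr)

theorem integral_inner_eq_zero (h : IsCapFamily n w ξ s) (hr : r ∈ Ioo (-1 : ℝ) 1) (hp : ‖p‖ = 1)
    (t : Eu n) : ∫ x, (⟪t, x⟫ : ℝ) ∂renormMeasure w ξ r p = 0 := by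
  rw [integral_map (measurable_dMap _).aemeasurable (by fun_prop)]
  exact (h.renorm hr hp).integral_inner_eq_zero t

theorem transRho_eq_one (h : IsCapFamily n w ξ s) (hr : r ∈ Ioo (-1 : ℝ) 1) (hp : ‖p‖ = 1)
    {x : Eu n} (hx : ‖x‖ = 1) :
    transRho (ξ r p) (ξ (-r) (-p)) r p x = 1 := by
  have hr' := neg_mem_Ioo hr
  have hp' : ‖-p‖ = 1 := by rwa [norm_neg]
  have hT := isConf_transMap (h.norm_lt hr hp) (h.norm_lt hr' hp') hr hp
  have := h.prob
  have := isFiniteMeasure_capMeasure w (-r) (-p)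
  have := nullSingletonClass_capMeasure h.one_le w hp' hr'
  have := (isConf_dMap (h.norm_lt hr' hp')).nullSingletonClass_map
    (ae_norm_eq_one_capMeasure w hp' hr')
  refine hT.factor_eq_one (ν := renormMeasure w ξ (-r) (-p))
    ((h.isMaxDir hr' hp').measure_ne_zero h.one_le) (h.ae_norm_eq_one hr' hp')
    (h.integral_inner_eq_zero hr' hp') (fun t _ => ?_) x hx
  rw [← h.integral_inner_eq_zero hr hp t, ← h.map_renormMeasure hr hp,
    integral_map hT.measurable.aemeasurable (by fun_prop)]

theorem inner_transMap (h : IsCapFamily n w ξ s) (hr : r ∈ Ioo (-1 : ℝ) 1) (hp : ‖p‖ = 1)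
    {x y : Eu n} (hx : ‖x‖ = 1) (hy : ‖y‖ = 1) :
    ⟪transMap (ξ r p) (ξ (-r) (-p)) r p x, transMap (ξ r p) (ξ (-r) (-p)) r p y⟫ =
      (⟪x, y⟫ : ℝ) := by
  have hr' := neg_mem_Ioo hr
  have hp' : ‖-p‖ = 1 := by rwa [norm_neg]
  have := (isConf_transMap (h.norm_lt hr hp) (h.norm_lt hr' hp') hr hp).one_sub_inner x y hx hy
  rw [h.transRho_eq_one hr hp hx, h.transRho_eq_one hr hp hy] at this
  linarith

theorem Qform_transMap (h : IsCapFamily n w ξ s) (hr : r ∈ Ioo (-1 : ℝ) 1) (hp : ‖p‖ = 1)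
    {x : Eu n} (hx : ‖x‖ = 1) :
    Qform (renormMeasure w ξ r p) (transMap (ξ r p) (ξ (-r) (-p)) r p x) =
      Qform (renormMeasure w ξ (-r) (-p)) x := by
  have hr' := neg_mem_Ioo hr
  have hp' : ‖-p‖ = 1 := by rwa [norm_neg]
  have hT := isConf_transMap (h.norm_lt hr hp) (h.norm_lt hr' hp') hr hp
  rw [Qform, Qform, ← h.map_renormMeasure hr hp,
    integral_map hT.measurable.aemeasurable (by fun_prop)]
  refine integral_congr_ae ((h.ae_norm_eq_one hr' hp').mono fun y hy => ?_)
  simp only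
  rw [h.inner_transMap hr hp hx hy]

theorem maxEig_neg_neg_le (h : IsCapFamily n w ξ s) (hr : r ∈ Ioo (-1 : ℝ) 1) (hp : ‖p‖ = 1) :
    maxEig n (renormMeasure w ξ (-r) (-p)) ≤ maxEig n (renormMeasure w ξ r p) := by
  have hr' := neg_mem_Ioo hr
  have hp' : ‖-p‖ = 1 := by rwa [norm_neg]
  have hT := isConf_transMap (h.norm_lt hr hp) (h.norm_lt hr' hp') hr hp
  have := h.prob
  have := isFiniteMeasure_capMeasure w r p
  have hs := h.isMaxDir hr' hp'
  rw [← hs.Qform_eq, ← h.Qform_transMap hr hp hs.1]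
  exact Qform_le_maxEig_of_norm_eq_one (h.ae_norm_eq_one hr hp) (hT.norm_eq _ hs.1)

theorem maxEig_neg_neg (h : IsCapFamily n w ξ s) (hr : r ∈ Ioo (-1 : ℝ) 1) (hp : ‖p‖ = 1) :
    maxEig n (renormMeasure w ξ (-r) (-p)) = maxEig n (renormMeasure w ξ r p) := by
  refine le_antisymm (h.maxEig_neg_neg_le hr hp) ?_
  simpa using h.maxEig_neg_neg_le (neg_mem_Ioo hr) (p := -p) (by rwa [norm_neg])

theorem transMap_dir_eq_or_eq_neg (h : IsCapFamily n w ξ s) (hr : r ∈ Ioo (-1 : ℝ) 1)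
    (hp : ‖p‖ = 1) :
    transMap (ξ r p) (ξ (-r) (-p)) r p (s (-r) (-p)) = s r p ∨
      transMap (ξ r p) (ξ (-r) (-p)) r p (s (-r) (-p)) = -s r p := by
  have hr' := neg_mem_Ioo hr
  have hp' : ‖-p‖ = 1 := by rwa [norm_neg]
  have hs := h.isMaxDir hr' hp'
  refine (h.isMaxDir hr hp).eq_or_eq_neg ((isConf_transMap (h.norm_lt hr hp)
    (h.norm_lt hr' hp') hr hp).norm_eq _ hs.1) ?_
  rw [h.Qform_transMap hr hp hs.1, hs.Qform_eq, h.maxEig_neg_neg hr hp]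

end IsCapFamily

end Transition

section Sign

variable {n : ℕ}

theorem continuousOn_dMap_comp {X : Type*} [TopologicalSpace X] {f g : X → Eu n} {A : Set X}
    (hf : ContinuousOn f A) (hg : ContinuousOn g A) (hf1 : ∀ x ∈ A, ‖f x‖ < 1)
    (hg1 : ∀ x ∈ A, ‖g x‖ = 1) : ContinuousOn (fun x => dMap (f x) (g x)) A := by
  have hfg : ContinuousOn (fun x => (⟪f x, g x⟫ : ℝ)) A := hf.inner hg
  have hden : ContinuousOn (fun x => 1 + 2 * (⟪f x, g x⟫ : ℝ) + ‖g x‖ ^ 2 * ‖f x‖ ^ 2) A := by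
    fun_prop
  have hinv : ContinuousOn
      (fun x => (1 + 2 * (⟪f x, g x⟫ : ℝ) + ‖g x‖ ^ 2 * ‖f x‖ ^ 2)⁻¹) A := by
    refine hden.inv₀ fun x hx => ?_
    rw [hg1 x hx, one_pow, one_mul]
    exact (dMap_denom_pos (hf1 x hx) (hg1 x hx)).ne'
  have hnum : ContinuousOn (fun x => (1 - ‖f x‖ ^ 2) • g x +
      (1 + 2 * (⟪f x, g x⟫ : ℝ) + ‖g x‖ ^ 2) • f x) A := by fun_prop
  exact hinv.smul hnum

theorem continuousOn_tauMap_comp {X : Type*} [TopologicalSpace X] {r : X → ℝ} {p g : X → Eu n}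
    {A : Set X} (hr : ContinuousOn r A) (hp : ContinuousOn p A) (hg : ContinuousOn g A)
    (hr1 : ∀ x ∈ A, r x ∈ Ioo (-1 : ℝ) 1) (hp1 : ∀ x ∈ A, ‖p x‖ = 1)
    (hg1 : ∀ x ∈ A, ‖g x‖ = 1) : ContinuousOn (fun x => tauMap (r x) (p x) (g x)) A := by
  have hrp := hr.smul hp
  have hlt : ∀ x ∈ A, ‖r x • p x‖ < 1 := fun x hx => norm_smul_lt_one (hp1 x hx) (hr1 x hx)
  have hlt' : ∀ x ∈ A, ‖-(r x • p x)‖ < 1 := fun x hx => by rw [norm_neg]; exact hlt x hx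
  have h1 := continuousOn_dMap_comp hrp.neg hg hlt' hg1
  have h2 : ContinuousOn (fun x => Refl (p x) (dMap (-(r x • p x)) (g x))) A := by
    unfold Refl
    exact h1.sub ((continuousOn_const.mul (hp.inner (𝕜 := ℝ) h1)).smul hp)
  refine continuousOn_dMap_comp hrp h2 hlt fun x hx => ?_
  rw [Function.comp, norm_Refl (hp1 x hx)]
  exact (isConf_dMap (hlt' x hx)).norm_eq _ (hg1 x hx)

theorem continuousOn_transMap_comp {X : Type*} [TopologicalSpace X] {f f' p g : X → Eu n}
    {r : X → ℝ} {A : Set X} (hf : ContinuousOn f A) (hf' : ContinuousOn f' A)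
    (hr : ContinuousOn r A) (hp : ContinuousOn p A) (hg : ContinuousOn g A)
    (hf1 : ∀ x ∈ A, ‖f x‖ < 1) (hf1' : ∀ x ∈ A, ‖f' x‖ < 1)
    (hr1 : ∀ x ∈ A, r x ∈ Ioo (-1 : ℝ) 1) (hp1 : ∀ x ∈ A, ‖p x‖ = 1)
    (hg1 : ∀ x ∈ A, ‖g x‖ = 1) :
    ContinuousOn (fun x => transMap (f x) (f' x) (r x) (p x) (g x)) A := by
  have hlt : ∀ x ∈ A, ‖-f' x‖ < 1 := fun x hx => by rw [norm_neg]; exact hf1' x hx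
  have hn : ∀ x ∈ A, ‖dMap (-f' x) (g x)‖ = 1 := fun x hx =>
    (isConf_dMap (hlt x hx)).norm_eq _ (hg1 x hx)
  exact continuousOn_dMap_comp hf (continuousOn_tauMap_comp hr hp
    (continuousOn_dMap_comp hf'.neg hg hlt hg1) hr1 hp1 hn) hf1
    fun x hx => (isConf_tauMap (hp1 x hx) (hr1 x hx)).norm_eq _ (hn x hx)

theorem rho_neg_dMap {ξ x : Eu n} (hξ : ‖ξ‖ < 1) (hx : ‖x‖ = 1) :
    rho (-ξ) (dMap ξ x) = (rho ξ x)⁻¹ := by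
  have h1 := (dMap_denom_pos hξ hx).ne'
  have h2 := (one_sub_norm_sq_pos hξ).ne'
  have hden : 1 + 2 * ⟪-ξ, dMap ξ x⟫ + ‖-ξ‖ ^ 2 =
      (1 - ‖ξ‖ ^ 2) ^ 2 / (1 + 2 * ⟪ξ, x⟫ + ‖ξ‖ ^ 2) := by
    rw [inner_neg_left, inner_dMap _ _ hx, norm_neg, real_inner_self_eq_norm_sq]
    field_simp
    ring
  rw [rho, hden, rho, norm_neg]
  field_simp

theorem eq_of_rho_eq {ξ η : Eu n} (hξ : ‖ξ‖ < 1) (hη : ‖η‖ < 1)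
    (h : ∀ x, ‖x‖ = 1 → rho ξ x = rho η x) : ξ = η := by
  have key : ∀ x : Eu n, ‖x‖ = 1 → (1 - ‖ξ‖ ^ 2) * (1 + 2 * ⟪η, x⟫ + ‖η‖ ^ 2) =
      (1 - ‖η‖ ^ 2) * (1 + 2 * ⟪ξ, x⟫ + ‖ξ‖ ^ 2) := fun x hx =>
    (div_eq_div_iff (dMap_denom_pos hξ hx).ne' (dMap_denom_pos hη hx).ne').1 (h x hx)
  have hneg : ∀ x : Eu n, ‖x‖ = 1 → ‖ξ‖ ^ 2 = ‖η‖ ^ 2 ∧ ⟪ξ - η, x⟫ = (0 : ℝ) := by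
    intro x hx
    have h1 := key x hx
    have h2 := key (-x) (by rwa [norm_neg])
    rw [inner_neg_right, inner_neg_right] at h2
    have h3 : ‖ξ‖ ^ 2 = ‖η‖ ^ 2 := by linarith
    refine ⟨h3, ?_⟩
    rw [h3] at h1
    have := mul_left_cancel₀ (one_sub_norm_sq_pos hη).ne' h1
    rw [inner_sub_left]
    linarith
  by_contra hne
  have hne' : ‖ξ - η‖ ≠ 0 := norm_ne_zero_iff.2 (sub_ne_zero.2 hne)
  have := (hneg (‖ξ - η‖⁻¹ • (ξ - η))
    (by rw [norm_smul, norm_inv, norm_norm, inv_mul_cancel₀ hne'])).2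
  rw [inner_smul_right, real_inner_self_eq_norm_sq] at this
  field_simp at this
  exact hne' this

namespace IsCapFamily

variable {w : Eu n → ℝ} {ξ s : ℝ → Eu n → Eu n}

theorem continuousOn_sign (h : IsCapFamily n w ξ s) :
    ContinuousOn (fun q : ℝ × Eu n =>
      (⟪transMap (ξ q.1 q.2) (ξ (-q.1) (-q.2)) q.1 q.2 (s (-q.1) (-q.2)), s q.1 q.2⟫ : ℝ))
      (Ioo (-1 : ℝ) 1 ×ˢ sphSet n) := by
  have hmem : ∀ q ∈ Ioo (-1 : ℝ) 1 ×ˢ sphSet n, q.1 ∈ Ioo (-1 : ℝ) 1 ∧ ‖q.2‖ = 1 := fun q hq =>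
    ⟨hq.1, mem_sphere_zero_iff_norm.1 hq.2⟩
  have hmem' : ∀ q ∈ Ioo (-1 : ℝ) 1 ×ˢ sphSet n, -q.1 ∈ Ioo (-1 : ℝ) 1 ∧ ‖-q.2‖ = 1 :=
    fun q hq => ⟨neg_mem_Ioo hq.1, by rw [norm_neg]; exact (hmem q hq).2⟩
  have hmaps : MapsTo (fun q : ℝ × Eu n => (-q.1, -q.2)) (Ioo (-1 : ℝ) 1 ×ˢ sphSet n)
      (Ioo (-1 : ℝ) 1 ×ˢ sphSet n) := fun q hq =>
    ⟨(hmem' q hq).1, mem_sphere_zero_iff_norm.2 (hmem' q hq).2⟩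
  have hnegc : ContinuousOn (fun q : ℝ × Eu n => (-q.1, -q.2)) (Ioo (-1 : ℝ) 1 ×ˢ sphSet n) := by
    fun_prop
  have hs := h.continuousOn_dir.mono
    (prod_mono (Ioo_subset_Ico_self : Ioo (-1 : ℝ) 1 ⊆ _) (subset_refl (sphSet n)))
  have hs' : ContinuousOn (fun q : ℝ × Eu n => s (-q.1) (-q.2)) (Ioo (-1 : ℝ) 1 ×ˢ sphSet n) :=
    hs.comp hnegc hmaps
  have hξ' : ContinuousOn (fun q : ℝ × Eu n => ξ (-q.1) (-q.2)) (Ioo (-1 : ℝ) 1 ×ˢ sphSet n) :=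
    h.continuousOn_point.comp hnegc hmaps
  have hlt' : ∀ q ∈ Ioo (-1 : ℝ) 1 ×ˢ sphSet n, ‖ξ (-q.1) (-q.2)‖ < 1 := fun q hq =>
    h.norm_lt (hmem' q hq).1 (hmem' q hq).2
  have hn' : ∀ q ∈ Ioo (-1 : ℝ) 1 ×ˢ sphSet n, ‖s (-q.1) (-q.2)‖ = 1 := fun q hq =>
    (h.isMaxDir (hmem' q hq).1 (hmem' q hq).2).1
  have hT := continuousOn_transMap_comp h.continuousOn_point hξ' continuousOn_fst continuousOn_snd
    hs' (fun q hq => h.norm_lt (hmem q hq).1 (hmem q hq).2) hlt' (fun q hq => (hmem q hq).1)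
    (fun q hq => (hmem q hq).2) hn'
  exact hT.inner (𝕜 := ℝ) hs

theorem transMap_dir_eq_or_forall_eq_neg (h : IsCapFamily n w ξ s) :
    (∀ r ∈ Ioo (-1 : ℝ) 1, ∀ p : Eu n, ‖p‖ = 1 →
      transMap (ξ r p) (ξ (-r) (-p)) r p (s (-r) (-p)) = s r p) ∨
    ∀ r ∈ Ioo (-1 : ℝ) 1, ∀ p : Eu n, ‖p‖ = 1 →
      transMap (ξ r p) (ξ (-r) (-p)) r p (s (-r) (-p)) = -s r p := by
  have hpre : IsPreconnected (Ioo (-1 : ℝ) 1 ×ˢ sphSet n) := by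
    refine isPreconnected_Ioo.prod (isPreconnected_sphere ?_ _ _)
    rw [← Module.finrank_eq_rank, finrank_euclideanSpace_fin]
    exact_mod_cast Nat.lt_succ_of_le h.one_le
  have hval : ∀ r ∈ Ioo (-1 : ℝ) 1, ∀ p : Eu n, ‖p‖ = 1 → ⟪s r p, s r p⟫ = (1 : ℝ) :=
    fun r hr p hp => by rw [real_inner_self_eq_norm_sq, (h.isMaxDir hr hp).1, one_pow]
  rcases hpre.eq_one_or_eq_neg_one_of_sq_eq h.continuousOn_sign (by
    rintro ⟨r, p⟩ ⟨hr, hp⟩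
    have hp' : ‖p‖ = 1 := mem_sphere_zero_iff_norm.1 hp
    simp only [Pi.pow_apply, Pi.one_apply]
    rcases h.transMap_dir_eq_or_eq_neg hr hp' with he | he
    · rw [he, hval r hr p hp', one_pow]
    · rw [he, inner_neg_left, hval r hr p hp', neg_one_sq]) with h1 | h1
  · left
    intro r hr p hp
    have := h1 (x := (r, p)) ⟨hr, mem_sphere_zero_iff_norm.2 hp⟩
    refine (h.transMap_dir_eq_or_eq_neg hr hp).resolve_right fun he => ?_
    simp only [Pi.one_apply, he, inner_neg_left, hval r hr p hp] at this
    norm_num at this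
  · right
    intro r hr p hp
    have := h1 (x := (r, p)) ⟨hr, mem_sphere_zero_iff_norm.2 hp⟩
    refine (h.transMap_dir_eq_or_eq_neg hr hp).resolve_left fun he => ?_
    simp only [Pi.neg_apply, Pi.one_apply, he, hval r hr p hp] at this
    norm_num at this

theorem transMap_zero_eq_Refl (h : IsCapFamily n w ξ s) {p : Eu n} (hp : ‖p‖ = 1) {x : Eu n}
    (hx : ‖x‖ = 1) : transMap (ξ 0 p) (ξ (-0) (-p)) 0 p x = Refl p x := by
  have h0 : (0 : ℝ) ∈ Ioo (-1 : ℝ) 1 := by norm_num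
  have hξ := h.norm_lt h0 hp
  have hξ' := h.norm_lt (neg_mem_Ioo h0) (p := -p) (by rwa [norm_neg])
  have hR : ‖Refl p (ξ 0 p)‖ < 1 := by rwa [norm_Refl hp]
  have hrho : ∀ y, ‖y‖ = 1 → rho (Refl p (ξ 0 p)) y = rho (ξ (-0) (-p)) y := by
    intro y hy
    have hdy := (isConf_dMap hξ').norm_eq y hy
    have h1 := h.transRho_eq_one h0 hp hdy
    have hτ : tauRho 0 p y = 1 := by simp [tauRho, rho]
    rw [transRho, dMap_neg_dMap hξ' hy, tauMap_zero, hτ, one_mul, rho_neg_dMap hξ' hy] at h1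
    have hpos := ((isConf_dMap hξ').pos y hy).ne'
    rw [← div_eq_mul_inv, div_eq_one_iff_eq hpos] at h1
    rw [← h1, rho, rho, norm_Refl hp, ← inner_Refl_Refl hp (ξ 0 p) (Refl p y), Refl_Refl hp]
  have he := eq_of_rho_eq hR hξ' hrho
  have hR' := Refl_dMap hp (ξ 0 p) (Refl p (dMap (-Refl p (ξ 0 p)) x))
  rw [Refl_Refl hp, dMap_dMap_neg hR hx] at hR'
  rw [transMap, Function.comp, Function.comp, tauMap_zero, ← he]
  exact (Refl_Refl hp _).symm.trans (congrArg (Refl p) hR')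

end IsCapFamily

end Sign

section AntipodalSign

variable {n : ℕ}

theorem Refl_eq_reflAlong {x y : Eu n} (hx : x ≠ 0) : Refl (‖x‖⁻¹ • x) y = reflAlong x y := by
  have hx' : ‖x‖ ≠ 0 := norm_ne_zero_iff.2 hx
  rw [Refl, reflAlong, inner_smul_left, smul_smul, conj_trivial]
  congr 2
  field_simp

theorem norm_inv_norm_smul {x : Eu n} (hx : x ≠ 0) : ‖‖x‖⁻¹ • x‖ = 1 := by
  rw [norm_smul, norm_inv, norm_norm, inv_mul_cancel₀ (norm_ne_zero_iff.2 hx)]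

namespace IsCapFamily

variable {w : Eu n → ℝ} {ξ s : ℝ → Eu n → Eu n}

/-- The extension of `s 0` to a map of `Eu n`, given by the other caps on the unit ball. -/
def dirExtension (s : ℝ → Eu n → Eu n) (x : Eu n) : Eu n :=
  if x = 0 then -(e1 n) else s (min ‖x‖ 1 - 1) (‖x‖⁻¹ • x)

theorem radius_mem {x : Eu n} (hx : x ≠ 0) : min ‖x‖ 1 - 1 ∈ Ioo (-1 : ℝ) 1 := by
  have h1 := norm_pos_iff.2 hx
  exact ⟨by linarith [lt_min h1 one_pos], by linarith [min_le_right ‖x‖ 1]⟩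

theorem norm_dirExtension (h : IsCapFamily n w ξ s) (x : Eu n) : ‖dirExtension s x‖ = 1 := by
  rw [dirExtension]
  split_ifs with hx
  · rw [norm_neg, h.isMaxDir_e1.1]
  · exact (h.isMaxDir (radius_mem hx) (norm_inv_norm_smul hx)).1

theorem continuous_dirExtension (h : IsCapFamily n w ξ s) : Continuous (dirExtension s) := by
  rw [continuous_iff_continuousAt]
  intro x
  by_cases hx : x = 0
  · subst hx
    rw [Metric.continuousAt_iff]
    intro ε hε
    have hK : IsCompact (Icc (-1 : ℝ) 0 ×ˢ sphSet n) := isCompact_Icc.prod (isCompact_sphere _ _)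
    have hKs : Icc (-1 : ℝ) 0 ×ˢ sphSet n ⊆ Ico (-1 : ℝ) 1 ×ˢ sphSet n :=
      prod_mono (fun r hr => ⟨hr.1, hr.2.trans_lt one_pos⟩) subset_rfl
    obtain ⟨δ, hδ, H⟩ := Metric.uniformContinuousOn_iff.1
      (hK.uniformContinuousOn_of_continuous (h.continuousOn_dir.mono hKs)) ε hε
    refine ⟨δ, hδ, fun {y} hy => ?_⟩
    rw [dirExtension, dirExtension, if_pos rfl]
    split_ifs with hy0
    · simpa using hε
    have hp := norm_inv_norm_smul hy0
    have hp' := mem_sphere_zero_iff_norm.2 hp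
    rw [← h.dir_neg_one hp]
    rw [dist_zero_right] at hy
    have hmin : 0 ≤ min ‖y‖ 1 := le_min (norm_nonneg y) zero_le_one
    refine H (min ‖y‖ 1 - 1, ‖y‖⁻¹ • y) ⟨⟨by simp, ?_⟩, hp'⟩ (-1, ‖y‖⁻¹ • y)
      ⟨⟨le_rfl, by norm_num⟩, hp'⟩ ?_
    · exact sub_nonpos.2 (min_le_right _ _)
    · rw [Prod.dist_eq, dist_self, max_eq_left dist_nonneg, Real.dist_eq,
        sub_neg_eq_add, sub_add_cancel, abs_of_nonneg hmin]
      exact (min_le_left _ _).trans_lt hy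
  · have hev : dirExtension s =ᶠ[𝓝 x] fun y => s (min ‖y‖ 1 - 1) (‖y‖⁻¹ • y) := by
      filter_upwards [isOpen_ne.mem_nhds hx] with y hy
      rw [dirExtension, if_neg hy]
    refine ContinuousAt.congr ?_ hev.symm
    have hc : ContinuousOn (fun y : Eu n => (min ‖y‖ 1 - 1, ‖y‖⁻¹ • y)) {0}ᶜ := by
      refine ContinuousOn.prodMk (by fun_prop) ?_
      exact (continuousOn_id.norm.inv₀ fun y hy => norm_ne_zero_iff.2 hy).smul continuousOn_id
    have hm : MapsTo (fun y : Eu n => (min ‖y‖ 1 - 1, ‖y‖⁻¹ • y)) {0}ᶜ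
        (Ico (-1 : ℝ) 1 ×ˢ sphSet n) := fun y hy =>
      ⟨Ioo_subset_Ico_self (radius_mem hy), mem_sphere_zero_iff_norm.2 (norm_inv_norm_smul hy)⟩
    exact (h.continuousOn_dir.comp hc hm).continuousAt (isOpen_compl_singleton.mem_nhds hx)

theorem transMap_dir_eq_neg (h : IsCapFamily n w ξ s) {r : ℝ} (hr : r ∈ Ioo (-1 : ℝ) 1) {p : Eu n}
    (hp : ‖p‖ = 1) : transMap (ξ r p) (ξ (-r) (-p)) r p (s (-r) (-p)) = -s r p := by
  refine h.transMap_dir_eq_or_forall_eq_neg.resolve_left (fun hpos => ?_) r hr p hp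
  have h0 : (0 : ℝ) ∈ Ioo (-1 : ℝ) 1 := by norm_num
  refine not_exists_twisted_extension (dirExtension s) h.continuous_dirExtension
    h.norm_dirExtension fun x hx => ?_
  have hx0 : x ≠ 0 := norm_pos_iff.1 (one_pos.trans_le hx)
  have hq := norm_inv_norm_smul hx0
  have hq' : ‖-(‖x‖⁻¹ • x)‖ = 1 := by rwa [norm_neg]
  have h1 := hpos 0 h0 _ hq
  rw [h.transMap_zero_eq_Refl hq (h.isMaxDir (neg_mem_Ioo h0) hq').1, neg_zero] at h1
  rw [dirExtension, dirExtension, if_neg (neg_ne_zero.2 hx0), if_neg hx0, norm_neg,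
    min_eq_right hx, sub_self, smul_neg, ← h1, ← Refl_eq_reflAlong hx0, Refl_Refl hq]

end IsCapFamily

end AntipodalSign

section Limits

variable {n : ℕ}

theorem tendsto_dMap {l : Filter ℝ} {f : ℝ → Eu n} {ξ x : Eu n} (hf : Tendsto f l (𝓝 ξ))
    (hξ : ‖ξ‖ < 1) (hx : ‖x‖ = 1) : Tendsto (fun r => dMap (f r) x) l (𝓝 (dMap ξ x)) := by
  have hc : ContinuousOn (fun η : Eu n => dMap η x) (ball 0 1) :=
    continuousOn_dMap_comp continuousOn_id continuousOn_const
      (fun η hη => mem_ball_zero_iff.1 hη) fun _ _ => hx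
  exact (hc.continuousAt (isOpen_ball.mem_nhds (mem_ball_zero_iff.2 hξ))).tendsto.comp hf

theorem measurable_testFun (ξ : Eu n) {r : ℝ} (hr : r ∈ Ioo (-1 : ℝ) 1) {p : Eu n} (hp : ‖p‖ = 1)
    (s : Eu n) : Measurable (testFun n ξ r p s) := by
  have hset : MeasurableSet {x : Eu n | 0 < ⟪p, dMap (-(r • p)) x⟫} :=
    measurableSet_lt measurable_const (measurable_const.inner (measurable_dMap _))
  exact Measurable.ite hset (measurable_const.inner (measurable_dMap ξ))
    (measurable_const.inner ((measurable_dMap ξ).comp (isConf_tauMap hp hr).measurable))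

theorem abs_testFun_le {ξ : Eu n} (hξ : ‖ξ‖ < 1) {r : ℝ} (hr : r ∈ Ioo (-1 : ℝ) 1) {p : Eu n}
    (hp : ‖p‖ = 1) {s : Eu n} (hs : ‖s‖ = 1) {x : Eu n} (hx : ‖x‖ = 1) :
    |testFun n ξ r p s x| ≤ 1 := by
  have key : ∀ y : Eu n, ‖y‖ = 1 → |Xfun s (dMap ξ y)| ≤ 1 := fun y hy => by
    simpa [Xfun, hs, (isConf_dMap hξ).norm_eq y hy] using abs_real_inner_le_norm s (dMap ξ y)
  rw [testFun]
  split_ifs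
  · exact key x hx
  · exact key _ ((isConf_tauMap hp hr).norm_eq x hx)

theorem tendsto_integral_sq_sub {ν : Measure (Eu n)} [IsFiniteMeasure ν]
    (hsph : ∀ᵐ x ∂ν, ‖x‖ = 1) {l : Filter ℝ} [l.IsCountablyGenerated] {F : ℝ → Eu n → ℝ}
    {G : Eu n → ℝ} (hF : ∀ᶠ r in l, Measurable (F r)) (hG : Measurable G)
    (hF1 : ∀ᶠ r in l, ∀ x, ‖x‖ = 1 → |F r x| ≤ 1) (hG1 : ∀ x, ‖x‖ = 1 → |G x| ≤ 1)
    (hlim : ∀ᵐ x ∂ν, Tendsto (fun r => F r x) l (𝓝 (G x))) :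
    Tendsto (fun r => ∫ x, (F r x - G x) ^ 2 ∂ν) l (𝓝 0) := by
  rw [← integral_zero (Eu n) ℝ (μ := ν)]
  refine tendsto_integral_filter_of_dominated_convergence (fun _ => 4) ?_ ?_
    (integrable_const _) ?_
  · filter_upwards [hF] with r hr
    exact ((hr.sub hG).pow_const 2).aestronglyMeasurable
  · filter_upwards [hF1] with r hr
    filter_upwards [hsph] with x hx
    have h1 := abs_le.1 (hr x hx)
    have h2 := abs_le.1 (hG1 x hx)
    rw [Real.norm_of_nonneg (sq_nonneg _)]
    nlinarith
  · filter_upwards [hlim] with x hx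
    simpa using (hx.sub_const (G x)).pow 2

theorem measurable_Xfun (s : Eu n) : Measurable (Xfun s) := by
  unfold Xfun
  fun_prop

theorem abs_Xfun_le {s x : Eu n} (hs : ‖s‖ = 1) (hx : ‖x‖ = 1) : |Xfun s x| ≤ 1 := by
  simpa [Xfun, hs, hx] using abs_real_inner_le_norm s x

namespace IsCapFamily

variable {w : Eu n → ℝ} {ξ s : ℝ → Eu n → Eu n}

theorem tendsto_testFun (h : IsCapFamily n w ξ s) {p : Eu n} (hp : ‖p‖ = 1) {r₀ : ℝ}
    (hr₀ : r₀ ∈ Ioo (-1 : ℝ) 1) {x : Eu n} (hx : ‖x‖ = 1) :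
    Tendsto (fun r => testFun n (ξ r p) r p (s r p) x) (𝓝[Ioo (-1 : ℝ) 1] r₀)
      (𝓝 (testFun n (ξ r₀ p) r₀ p (s r₀ p) x)) := by
  have hpm := mem_sphere_zero_iff_norm.2 hp
  have hpair : ContinuousOn (fun r : ℝ => (r, p)) (Ioo (-1 : ℝ) 1) := by fun_prop
  have hξ : ContinuousOn (fun r => ξ r p) (Ioo (-1 : ℝ) 1) :=
    h.continuousOn_point.comp hpair fun r hr => ⟨hr, hpm⟩
  have hs : ContinuousOn (fun r => s r p) (Ioo (-1 : ℝ) 1) :=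
    h.continuousOn_dir.comp hpair fun r hr => ⟨Ioo_subset_Ico_self hr, hpm⟩
  have hξ1 : ∀ r ∈ Ioo (-1 : ℝ) 1, ‖ξ r p‖ < 1 := fun r hr => h.norm_lt hr hp
  have hrp : ContinuousOn (fun r : ℝ => -(r • p)) (Ioo (-1 : ℝ) 1) := by fun_prop
  have hc : ContinuousOn (fun r : ℝ => (⟪p, dMap (-(r • p)) x⟫ : ℝ)) (Ioo (-1 : ℝ) 1) :=
    continuousOn_const.inner (𝕜 := ℝ) (continuousOn_dMap_comp hrp continuousOn_const
      (fun r hr => by rw [norm_neg]; exact norm_smul_lt_one hp hr) fun _ _ => hx)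
  have hA : ContinuousOn (fun r => Xfun (s r p) (dMap (ξ r p) x)) (Ioo (-1 : ℝ) 1) :=
    hs.inner (𝕜 := ℝ) (continuousOn_dMap_comp hξ continuousOn_const hξ1 fun _ _ => hx)
  have hτ : ContinuousOn (fun r => tauMap r p x) (Ioo (-1 : ℝ) 1) :=
    continuousOn_tauMap_comp continuousOn_id continuousOn_const continuousOn_const
      (fun _ hr => hr) (fun _ _ => hp) fun _ _ => hx
  have hB : ContinuousOn (fun r => Xfun (s r p) (dMap (ξ r p) (tauMap r p x))) (Ioo (-1 : ℝ) 1) :=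
    hs.inner (𝕜 := ℝ) (continuousOn_dMap_comp hξ hτ hξ1
      fun r hr => (isConf_tauMap hp hr).norm_eq x hx)
  simp only [testFun]
  rcases lt_trichotomy 0 (⟪p, dMap (-(r₀ • p)) x⟫ : ℝ) with hlt | heq | hgt
  · rw [if_pos hlt]
    refine (hA r₀ hr₀).tendsto.congr' ?_
    filter_upwards [(hc r₀ hr₀).eventually (lt_mem_nhds hlt)] with r hr
    rw [if_pos hr]
  · have he := tauMap_eq_self hp hr₀ hx heq.symm
    rw [he, ite_self]
    refine Tendsto.if' (hA r₀ hr₀) ?_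
    have := (hB r₀ hr₀).tendsto
    rwa [he] at this
  · rw [if_neg hgt.not_gt]
    refine (hB r₀ hr₀).tendsto.congr' ?_
    filter_upwards [(hc r₀ hr₀).eventually (gt_mem_nhds hgt)] with r hr
    rw [if_neg (not_lt.2 (le_of_lt hr))]

theorem tendsto_inner_dMap (h : IsCapFamily n w ξ s) {p : Eu n} (hp : ‖p‖ = 1) {x : Eu n}
    (hx : ‖x‖ = 1) :
    Tendsto (fun r => Xfun (s r p) (dMap (ξ r p) x)) (𝓝[Ioo (-1 : ℝ) 1] (-1))
      (𝓝 (-Xfun (e1 n) x)) := by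
  have hs : Tendsto (fun r => s r p) (𝓝[Ioo (-1 : ℝ) 1] (-1)) (𝓝 (-(e1 n))) := by
    have hpair : ContinuousOn (fun r : ℝ => (r, p)) (Ico (-1 : ℝ) 1) := by fun_prop
    have hs : ContinuousOn (fun r => s r p) (Ico (-1 : ℝ) 1) :=
      h.continuousOn_dir.comp hpair fun r hr => ⟨hr, mem_sphere_zero_iff_norm.2 hp⟩
    have := (hs (-1) (by norm_num)).tendsto
    rw [h.dir_neg_one hp] at this
    exact this.mono_left (nhdsWithin_mono _ Ioo_subset_Ico_self)
  have hd := tendsto_dMap (h.tendsto_point hp) (by simp) hx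
  rw [dMap_zero] at hd
  have := hs.inner (𝕜 := ℝ) hd
  rwa [inner_neg_left] at this

theorem tendsto_testFun_neg_one (h : IsCapFamily n w ξ s) {p : Eu n} (hp : ‖p‖ = 1) {x : Eu n}
    (hx : ‖x‖ = 1) (hxp : x ≠ -p) :
    Tendsto (fun r => testFun n (ξ r p) r p (s r p) x) (𝓝[Ioo (-1 : ℝ) 1] (-1))
      (𝓝 (-Xfun (e1 n) x)) := by
  refine (h.tendsto_inner_dMap hp hx).congr' ?_
  filter_upwards [eventually_inner_dMap_pos hp hx hxp] with r hr
  rw [testFun, if_pos hr]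

theorem tendsto_testFun_one (h : IsCapFamily n w ξ s) {p : Eu n} (hp : ‖p‖ = 1) {x : Eu n}
    (hx : ‖x‖ = 1) (hxp : x ≠ p) :
    Tendsto (fun r => testFun n (ξ r p) r p (s r p) x) (𝓝[Ioo (-1 : ℝ) 1] 1)
      (𝓝 (Xfun (e1 n) x)) := by
  have hp' : ‖-p‖ = 1 := by rwa [norm_neg]
  have hneg : Tendsto (fun r : ℝ => -r) (𝓝[Ioo (-1 : ℝ) 1] 1) (𝓝[Ioo (-1 : ℝ) 1] (-1)) :=
    tendsto_nhdsWithin_of_tendsto_nhds_of_eventually_within _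
      (continuous_neg.continuousAt.tendsto.mono_left nhdsWithin_le_nhds)
      (eventually_mem_nhdsWithin.mono fun r hr => neg_mem_Ioo hr)
  have hlim := ((h.tendsto_inner_dMap hp' hx).comp hneg).neg
  rw [neg_neg] at hlim
  refine hlim.congr' ?_
  filter_upwards [hneg.eventually (eventually_inner_dMap_pos hp' hx (by rwa [neg_neg])),
    self_mem_nhdsWithin] with r hr hr1
  rw [neg_smul_neg, inner_neg_left, neg_pos] at hr
  have hr' := neg_mem_Ioo hr1
  have hξ' := h.norm_lt hr' hp'
  rw [testFun, if_neg hr.not_gt, ← transMap_dMap (ξ r p) hξ' r p hx, Function.comp, Xfun, Xfun,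
    ← h.inner_transMap hr1 hp (h.isMaxDir hr' hp').1 ((isConf_dMap hξ').norm_eq x hx),
    h.transMap_dir_eq_neg hr1 hp, inner_neg_left, neg_neg]

end IsCapFamily

end Limits

/-- With `ψ_r = u_{a_{r,e₁}}^{s(a_{r,e₁})}` and `φ = X_{e₁}`, the map
`r ∈ (-1,1) ↦ ψ_r ∈ L²(S^n, dv_g)` is continuous, `ψ_r → -φ` in `L²` as `r → -1`, and
`ψ_r → φ` in `L²` as `r → 1`. -/
theorem testFun_continuous_in_L2 (n : ℕ) (hn : 2 ≤ n)
    (w : Eu n → ℝ) (hw : IsConformalFactor n w) (hvol : confMeasure n w Set.univ = 1)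
    (hmean : ∀ t : Eu n, ∫ x, (⟪t, x⟫ : ℝ) ∂(confMeasure n w) = 0)
    (hsimple : IsMaxDir (confMeasure n w) (e1 n))
    (ξfun : ℝ → Eu n → Eu n) (sfun : ℝ → Eu n → Eu n)
    (hξ : ∀ r ∈ Set.Ioo (-1 : ℝ) 1, ∀ p ∈ sphSet n,
      ‖ξfun r p‖ < 1 ∧ Renormalizes (ξfun r p) (capMeasure n w r p))
    (hξcont : ContinuousOn (fun q : ℝ × Eu n => ξfun q.1 q.2)
      (Set.Ioo (-1 : ℝ) 1 ×ˢ sphSet n))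
    (hmax : ∀ r ∈ Set.Ioo (-1 : ℝ) 1, ∀ p ∈ sphSet n,
      IsMaxDir (Measure.map (dMap (ξfun r p)) (capMeasure n w r p)) (sfun r p))
    (hscont : ContinuousOn (fun q : ℝ × Eu n => sfun q.1 q.2)
      (Set.Ico (-1 : ℝ) 1 ×ˢ sphSet n))
    (hinit : ∀ p ∈ sphSet n, sfun (-1) p = -(e1 n)) :
    (∀ r₀ ∈ Set.Ioo (-1 : ℝ) 1,
      Filter.Tendsto
        (fun r : ℝ => ∫ x, (testFun n (ξfun r (e1 n)) r (e1 n) (sfun r (e1 n)) x -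
          testFun n (ξfun r₀ (e1 n)) r₀ (e1 n) (sfun r₀ (e1 n)) x) ^ 2 ∂(confMeasure n w))
        (nhdsWithin r₀ (Set.Ioo (-1 : ℝ) 1)) (nhds 0)) ∧
    Filter.Tendsto
      (fun r : ℝ => ∫ x, (testFun n (ξfun r (e1 n)) r (e1 n) (sfun r (e1 n)) x +
        Xfun (e1 n) x) ^ 2 ∂(confMeasure n w))
      (nhdsWithin (-1 : ℝ) (Set.Ioo (-1 : ℝ) 1)) (nhds 0) ∧
    Filter.Tendsto
      (fun r : ℝ => ∫ x, (testFun n (ξfun r (e1 n)) r (e1 n) (sfun r (e1 n)) x -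
        Xfun (e1 n) x) ^ 2 ∂(confMeasure n w))
      (nhdsWithin (1 : ℝ) (Set.Ioo (-1 : ℝ) 1)) (nhds 0) := by
  have h : IsCapFamily n w ξfun sfun :=
    { one_le := by omega
      prob := ⟨hvol⟩
      mean := hmean
      isMaxDir_e1 := hsimple
      norm_lt := fun hr p hp => (hξ _ hr p (mem_sphere_zero_iff_norm.2 hp)).1
      renorm := fun hr p hp => (hξ _ hr p (mem_sphere_zero_iff_norm.2 hp)).2
      continuousOn_point := hξcont
      isMaxDir := fun hr p hp => hmax _ hr p (mem_sphere_zero_iff_norm.2 hp)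
      continuousOn_dir := hscont
      dir_neg_one := fun hp => hinit _ (mem_sphere_zero_iff_norm.2 hp) }
  have := h.prob
  have := nullSingletonClass_confMeasure h.one_le w
  have hσ := ae_norm_eq_one_confMeasure w
  have he : ‖e1 n‖ = 1 := hsimple.1
  have hmeas : ∀ r ∈ Ioo (-1 : ℝ) 1,
      Measurable (testFun n (ξfun r (e1 n)) r (e1 n) (sfun r (e1 n))) := fun r hr =>
    measurable_testFun _ hr he _
  have hbd : ∀ r ∈ Ioo (-1 : ℝ) 1, ∀ x, ‖x‖ = 1 →
      |testFun n (ξfun r (e1 n)) r (e1 n) (sfun r (e1 n)) x| ≤ 1 := fun r hr x hx =>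
    abs_testFun_le (h.norm_lt hr he) hr he (h.isMaxDir hr he).1 hx
  have hne : ∀ a : Eu n, ∀ᵐ x ∂confMeasure n w, x ≠ a := fun a =>
    measure_eq_zero_iff_ae_notMem.1 (measure_singleton a)
  refine ⟨fun r₀ hr₀ => ?_, ?_, ?_⟩
  · exact tendsto_integral_sq_sub hσ (eventually_mem_nhdsWithin.mono hmeas) (hmeas r₀ hr₀)
      (eventually_mem_nhdsWithin.mono hbd) (hbd r₀ hr₀)
      (hσ.mono fun x hx => h.tendsto_testFun he hr₀ hx)
  · simp only [← sub_neg_eq_add _ (Xfun (e1 n) _)]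
    refine tendsto_integral_sq_sub hσ (eventually_mem_nhdsWithin.mono hmeas)
      (measurable_Xfun _).neg (eventually_mem_nhdsWithin.mono hbd)
      (fun x hx => by rw [abs_neg]; exact abs_Xfun_le he hx) ?_
    filter_upwards [hσ, hne (-(e1 n))] with x hx hx'
    exact h.tendsto_testFun_neg_one he hx hx'
  · refine tendsto_integral_sq_sub hσ (eventually_mem_nhdsWithin.mono hmeas)
      (measurable_Xfun _) (eventually_mem_nhdsWithin.mono hbd)
      (fun x hx => abs_Xfun_le he hx) ?_
    filter_upwards [hσ, hne (e1 n)] with x hx hx'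
    exact h.tendsto_testFun_one he hx hx'

end
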